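/- Let F be a number field with class group Cl_F of class number h. Let p be a prime ideal whose class [p] lies in the 2-torsion subgroup Cl_F[2], and let m be any fractional ideal. Then there exist integral ideals n_1, n_2, n_3, n_4 and elements λ_1, λ_2, λ_3, λ_4 ∈ F such that (λ_1) = p n_1, (λ_2) = p n_2 m^{-1}, (λ_3) = p n_3 m, (λ_4) = p n_4, λ_1 λ_4 - λ_2 λ_3 generates p^2, n_1 and n_2 are distinct prime ideals not equal to p, and for every prime q ≠ p, min(ord_q(n_1), ord_q(n_2), ord_q(n_3), ord_q(n_4)) = 0. -/

import Mathlib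

open IsDedekindDomain NumberField FractionalIdeal
open scoped nonZeroDivisors

namespace PrimesInClasses

open MeasureTheory Module

section Lattice

set_option linter.unusedSectionVars false

variable {V : Type*} [NormedAddCommGroup V] [NormedSpace ℝ V] [FiniteDimensional ℝ V]
variable {ι : Type*} [Fintype ι]

/-- The lattice spanned by a basis. -/
abbrev lat (b : Basis ι ℝ V) : Submodule ℤ V := Submodule.span ℤ (Set.range b)

/-- Periodised sum of `g` dilated by `h`. -/
noncomputable def psum (b : Basis ι ℝ V) (g : V → ℝ) (h : ℝ) (θ : V) : ℝ :=
  ∑' ℓ : lat b, g (h • ((ℓ : V) + θ))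

/-- lattice points in a ball around `-θ`: finite, with a cardinality bound. -/
lemma lattice_count (b : Basis ι ℝ V) (R : ℝ) (hR : 0 ≤ R) :
    ∃ C : ℝ, 0 ≤ C ∧ ∀ h : ℝ, 0 < h → h ≤ 1 → ∀ θ : V, ∃ S : Finset (lat b),
      (∀ ℓ : lat b, ‖h • ((ℓ : V) + θ)‖ ≤ R → ℓ ∈ S) ∧
        (S.card : ℝ) ≤ C * (h⁻¹) ^ (Fintype.card ι) := by
  classical
  obtain ⟨c, hc0, hc⟩ : ∃ c : ℝ, 0 ≤ c ∧ ∀ i, ∀ v : V, |b.repr v i| ≤ c * ‖v‖ := by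
    let f : V →L[ℝ] (ι → ℝ) := LinearMap.toContinuousLinearMap b.equivFun.toLinearMap
    refine ⟨‖f‖, norm_nonneg _, fun i v => ?_⟩
    have h1 := f.le_opNorm v
    have h2 := norm_le_pi_norm (f v) i
    exact h2.trans h1
  refine ⟨(2 * (c * R) + 1) ^ (Fintype.card ι), by positivity, fun h h0 h1 θ => ?_⟩
  let bz : Basis ι ℤ (lat b) := b.restrictScalars ℤ
  let lo : ι → ℤ := fun i => ⌈-(c * R / h) - b.repr θ i⌉
  let hi : ι → ℤ := fun i => ⌊(c * R / h) - b.repr θ i⌋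
  let T : Finset (ι → ℤ) := Fintype.piFinset fun i => Finset.Icc (lo i) (hi i)
  refine ⟨T.map bz.equivFun.symm.toEquiv.toEmbedding, fun ℓ hℓ => ?_, ?_⟩
  · rw [Finset.mem_map]
    refine ⟨bz.equivFun ℓ, ?_, by simp⟩
    rw [Fintype.mem_piFinset]
    intro i
    have e1 : ((bz.equivFun ℓ i : ℤ) : ℝ) = b.repr (ℓ : V) i := by
      have := b.restrictScalars_repr_apply ℤ ℓ i
      simpa [bz] using this
    have e2 : |b.repr ((ℓ : V) + θ) i| ≤ c * R / h := by
      refine (hc i _).trans ?_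
      rw [norm_smul, Real.norm_eq_abs, abs_of_pos h0] at hℓ
      rw [mul_div_assoc]
      gcongr
      rw [le_div_iff₀ h0]; linarith
    rw [map_add, Finsupp.add_apply, ← e1, abs_le] at e2
    rw [Finset.mem_Icc]
    constructor
    · apply Int.ceil_le.mpr; linarith [e2.1]
    · apply Int.le_floor.mpr; linarith [e2.2]
  · rw [Finset.card_map, Fintype.card_piFinset, Nat.cast_prod, ← mul_pow]
    rw [← Finset.card_univ, ← Finset.prod_const]
    apply Finset.prod_le_prod
    · intros; positivity
    intro i _
    rw [Int.card_Icc]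
    have hpos : 0 ≤ (2 * (c * R) + 1) * h⁻¹ := by positivity
    have hh : 1 ≤ h⁻¹ := (one_le_inv₀ h0).mpr h1
    have a1 : ((hi i + 1 - lo i : ℤ) : ℝ) ≤ (2 * (c * R) + 1) * h⁻¹ := by
      push_cast
      have := Int.floor_le ((c * R / h) - b.repr θ i)
      have := Int.le_ceil (-(c * R / h) - b.repr θ i)
      have : c * R / h = c * R * h⁻¹ := rfl
      simp only [hi, lo]
      linarith
    rcases le_total 0 (hi i + 1 - lo i) with hq | hq
    · rw [← Int.cast_natCast, Int.toNat_of_nonneg hq]; exact a1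
    · rw [Int.toNat_of_nonpos hq]; simpa using hpos

lemma psum_eq_sum (b : Basis ι ℝ V) {g : V → ℝ} {R : ℝ} (hg : ∀ v, R < ‖v‖ → g v = 0)
    {h : ℝ} {θ : V} {S : Finset (lat b)} (hS : ∀ ℓ : lat b, ‖h • ((ℓ : V) + θ)‖ ≤ R → ℓ ∈ S) :
    psum b g h θ = ∑ ℓ ∈ S, g (h • ((ℓ : V) + θ)) := by
  apply tsum_eq_sum
  intro ℓ hℓ
  apply hg
  by_contra hcon
  exact hℓ (hS ℓ (not_lt.mp hcon))

lemma exists_radius {g : V → ℝ} (hg : HasCompactSupport g) :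
    ∃ R : ℝ, 0 ≤ R ∧ ∀ v, R < ‖v‖ → g v = 0 := by
  obtain ⟨R, hR⟩ := hg.isCompact.isBounded.exists_norm_le
  refine ⟨max R 0, le_max_right _ _, fun v hv => ?_⟩
  by_contra hne
  have := hR v (subset_tsupport _ hne)
  exact absurd this (not_le.mpr ((le_max_left _ _).trans_lt hv))

lemma psum_bound (b : Basis ι ℝ V) {g : V → ℝ} (hg : HasCompactSupport g) (hc : Continuous g) :
    ∃ C : ℝ, 0 ≤ C ∧ ∀ h : ℝ, 0 < h → h ≤ 1 → ∀ θ : V,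
      |psum b g h θ| ≤ C * (h⁻¹) ^ (Fintype.card ι) := by
  obtain ⟨R, hR, hgR⟩ := exists_radius hg
  obtain ⟨M, hM⟩ := hg.exists_bound_of_continuous hc
  obtain ⟨C, hC, hS⟩ := lattice_count b R hR
  have hM0 : 0 ≤ M := (norm_nonneg _).trans (hM 0)
  refine ⟨C * M, by positivity, fun h h0 h1 θ => ?_⟩
  obtain ⟨S, hS1, hS2⟩ := hS h h0 h1 θ
  rw [psum_eq_sum b hgR hS1]
  calc |∑ ℓ ∈ S, g (h • ((ℓ : V) + θ))| ≤ ∑ ℓ ∈ S, |g (h • ((ℓ : V) + θ))| :=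
        Finset.abs_sum_le_sum_abs _ _
    _ ≤ ∑ ℓ ∈ S, M := Finset.sum_le_sum fun ℓ _ => hM _
    _ = S.card * M := by simp
    _ ≤ (C * (h⁻¹) ^ (Fintype.card ι)) * M := by gcongr
    _ = _ := by ring

lemma psum_periodic (b : Basis ι ℝ V) (g : V → ℝ) (h : ℝ) (θ : V) (i : ι) :
    psum b g h (θ + b i) = psum b g h θ := by
  unfold psum
  have hmem : b i ∈ lat b := Submodule.subset_span ⟨i, rfl⟩
  rw [← (Equiv.addRight (⟨b i, hmem⟩ : lat b)).tsum_eq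
    (fun ℓ : lat b => g (h • ((ℓ : V) + θ)))]
  congr 1
  ext ℓ
  simp only [Equiv.coe_addRight, Submodule.coe_add]
  congr 2
  abel

/-- directional derivative -/
noncomputable def ddir (v : V) (g : V → ℝ) : V → ℝ := fun x => fderiv ℝ g x v

lemma ddir_contDiff {g : V → ℝ} (hg : ContDiff ℝ (⊤ : ℕ∞) g) (v : V) :
    ContDiff ℝ (⊤ : ℕ∞) (ddir v g) := by
  have : ContDiff ℝ (⊤ : ℕ∞) (fderiv ℝ g) := hg.fderiv_right (by simp)
  exact this.clm_apply contDiff_const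

lemma ddir_compact {g : V → ℝ} (hg : HasCompactSupport g) (v : V) :
    HasCompactSupport (ddir v g) := by
  have := hg.fderiv (𝕜 := ℝ)
  exact this.comp_left (g := fun L : V →L[ℝ] ℝ => L v) (by simp)

lemma psum_hasDerivAt (b : Basis ι ℝ V) {g : V → ℝ} (hg : ContDiff ℝ (⊤ : ℕ∞) g)
    (hc : HasCompactSupport g) {h : ℝ} (h0 : 0 < h) (h1 : h ≤ 1) (θ v : V) (s : ℝ) :
    HasDerivAt (fun s : ℝ => psum b g h (θ + s • v)) (h * psum b (ddir v g) h (θ + s • v)) s := by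
  obtain ⟨R1, hR1, hgR1⟩ := exists_radius hc
  obtain ⟨R2, hR2, hgR2⟩ := exists_radius (ddir_compact hc v)
  set R := max R1 R2 with hRdef
  obtain ⟨C, hC, hS⟩ := lattice_count b (R + ‖v‖) (by positivity)
  obtain ⟨S, hS1, -⟩ := hS h h0 h1 (θ + s • v)
  have key : ∀ s' : ℝ, |s' - s| ≤ 1 → ∀ ℓ : lat b, ‖h • ((ℓ : V) + (θ + s' • v))‖ ≤ R → ℓ ∈ S := by
    intro s' hs' ℓ hℓ
    apply hS1
    have e : h • ((ℓ : V) + (θ + s • v)) = h • ((ℓ : V) + (θ + s' • v)) - (h * (s' - s)) • v := by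
      rw [mul_smul, ← smul_sub]; congr 1; rw [sub_smul]; abel
    rw [e]
    refine (norm_sub_le _ _).trans ?_
    gcongr
    rw [norm_smul, Real.norm_eq_abs, abs_mul, abs_of_pos h0]
    have : h * |s' - s| ≤ 1 := by nlinarith [abs_nonneg (s' - s)]
    nlinarith [norm_nonneg v]
  have ev : (fun s' : ℝ => psum b g h (θ + s' • v)) =ᶠ[nhds s]
      fun s' => ∑ ℓ ∈ S, g (h • ((ℓ : V) + (θ + s' • v))) := by
    filter_upwards [Metric.ball_mem_nhds s one_pos] with s' hs'
    apply psum_eq_sum b (R := R) (fun v hv => hgR1 v ((le_max_left _ _).trans_lt hv))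
    apply key
    rw [Metric.mem_ball, Real.dist_eq] at hs'
    exact hs'.le
  have ed : psum b (ddir v g) h (θ + s • v) =
      ∑ ℓ ∈ S, ddir v g (h • ((ℓ : V) + (θ + s • v))) := by
    apply psum_eq_sum b (R := R) (fun v hv => hgR2 v ((le_max_right _ _).trans_lt hv))
    exact key s (by simp)
  refine HasDerivAt.congr_of_eventuallyEq ?_ ev
  rw [ed, Finset.mul_sum]
  apply HasDerivAt.fun_sum
  intro ℓ _
  have d1 : HasDerivAt (fun s' : ℝ => h • ((ℓ : V) + (θ + s' • v))) (h • v) s := by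
    have := (((hasDerivAt_id s).smul_const v).const_add θ).const_add (ℓ : V)
    have := this.const_smul h
    simp only [one_smul] at this
    exact this
  have d2 : HasFDerivAt g (fderiv ℝ g (h • ((ℓ : V) + (θ + s • v)))) (h • ((ℓ : V) + (θ + s • v))) :=
    (hg.differentiable (by simp) _).hasFDerivAt
  have := d2.comp_hasDerivAt s d1
  rw [map_smul, smul_eq_mul] at this
  exact this

lemma psum_step (b : Basis ι ℝ V) {g : V → ℝ} (hg : ContDiff ℝ (⊤ : ℕ∞) g)
    (hc : HasCompactSupport g) {h : ℝ} (h0 : 0 < h) (h1 : h ≤ 1) (i : ι) {B : ℝ}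
    (hB : ∀ θ, |psum b (ddir (b i) (ddir (b i) g)) h θ| ≤ B) (θ : V) :
    |psum b (ddir (b i) g) h θ| ≤ h * B := by
  have hF := fun s => psum_hasDerivAt b hg hc h0 h1 θ (b i) s
  have hG := fun s => psum_hasDerivAt b (ddir_contDiff hg (b i)) (ddir_compact hc (b i)) h0 h1 θ (b i) s
  obtain ⟨s1, hs1, hs2⟩ := exists_hasDerivAt_eq_zero (f := fun s : ℝ => psum b g h (θ + s • b i))
    (one_pos : (0 : ℝ) < 1)
    (fun s _ => (hF s).continuousAt.continuousWithinAt) (by simp [psum_periodic]) (fun s _ => hF s)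
  have hz : psum b (ddir (b i) g) h (θ + s1 • b i) = 0 := by
    rcases mul_eq_zero.mp hs2 with h' | h'
    · exact absurd h' h0.ne'
    · exact h'
  have := (convex_univ (𝕜 := ℝ) (E := ℝ)).norm_image_sub_le_of_norm_hasDerivWithin_le (C := h * B)
    (f := fun s : ℝ => psum b (ddir (b i) g) h (θ + s • b i))
    (fun s _ => (hG s).hasDerivWithinAt) (fun s _ => by
      rw [norm_mul, Real.norm_eq_abs, abs_of_pos h0]
      exact mul_le_mul_of_nonneg_left (hB _) h0.le) (Set.mem_univ s1) (Set.mem_univ 0)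
  simp only [zero_smul, add_zero, hz, sub_zero, zero_sub, norm_neg, Real.norm_eq_abs] at this
  refine this.trans ?_
  have hB0 : 0 ≤ B := (abs_nonneg _).trans (hB 0)
  have : |s1| ≤ 1 := by rw [abs_of_pos hs1.1]; exact hs1.2.le
  have hhB : 0 ≤ h * B := by positivity
  nlinarith

lemma psum_iter (b : Basis ι ℝ V) (i : ι) (K : ℕ) : ∀ {g : V → ℝ}, ContDiff ℝ (⊤ : ℕ∞) g →
    HasCompactSupport g → ∃ C : ℝ, 0 ≤ C ∧ ∀ h : ℝ, 0 < h → h ≤ 1 → ∀ θ : V,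
      |psum b (ddir (b i) g) h θ| ≤ C * h ^ K * (h⁻¹) ^ (Fintype.card ι) := by
  induction K with
  | zero =>
    intro g hg hc
    obtain ⟨C, hC, h⟩ := psum_bound b (ddir_compact hc (b i)) (ddir_contDiff hg (b i)).continuous
    exact ⟨C, hC, fun h' h0 h1 θ => by simpa using h h' h0 h1 θ⟩
  | succ K ih =>
    intro g hg hc
    obtain ⟨C, hC, h⟩ := ih (ddir_contDiff hg (b i)) (ddir_compact hc (b i))
    refine ⟨C, hC, fun h' h0 h1 θ => ?_⟩
    refine (psum_step b hg hc h0 h1 i (h h' h0 h1) θ).trans (le_of_eq ?_)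
    ring

lemma psum_move (b : Basis ι ℝ V) {g : V → ℝ} (hg : ContDiff ℝ (⊤ : ℕ∞) g)
    (hc : HasCompactSupport g) (K : ℕ) : ∃ C : ℝ, 0 ≤ C ∧ ∀ h : ℝ, 0 < h → h ≤ 1 →
      ∀ θ ∈ ZSpan.fundamentalDomain b, |psum b g h θ - psum b g h 0| ≤
        C * h ^ K * (h⁻¹) ^ (Fintype.card ι) := by
  classical
  choose C hC hCb using fun i => psum_iter b i K hg hc
  refine ⟨∑ i, C i, Finset.sum_nonneg fun i _ => hC i, fun h h0 h1 θ hθ => ?_⟩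
  have key : ∀ S : Finset ι, |psum b g h (∑ i ∈ S, b.repr θ i • b i) - psum b g h 0| ≤
      (∑ i ∈ S, C i) * h ^ K * (h⁻¹) ^ (Fintype.card ι) := by
    intro S
    induction S using Finset.induction_on with
    | empty => simp
    | insert i S hi ih =>
      rw [Finset.sum_insert hi, Finset.sum_insert hi]
      set w := ∑ i ∈ S, b.repr θ i • b i with hw
      have hF := fun s => psum_hasDerivAt b hg hc h0 h1 w (b i) s
      have hri := (ZSpan.mem_fundamentalDomain b).mp hθ i
      have := (convex_univ (𝕜 := ℝ) (E := ℝ)).norm_image_sub_le_of_norm_hasDerivWithin_le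
        (C := C i * h ^ K * (h⁻¹) ^ (Fintype.card ι))
        (f := fun s : ℝ => psum b g h (w + s • b i))
        (fun s _ => (hF s).hasDerivWithinAt) (fun s _ => by
          rw [norm_mul, Real.norm_eq_abs, abs_of_pos h0]
          have := hCb i h h0 h1 (w + s • b i)
          calc h * ‖psum b (ddir (b i) g) h (w + s • b i)‖ ≤
              1 * (C i * h ^ K * (h⁻¹) ^ (Fintype.card ι)) := by gcongr; exact this
            _ = _ := one_mul _) (Set.mem_univ 0) (Set.mem_univ (b.repr θ i))
      simp only [zero_smul, add_zero, sub_zero, Real.norm_eq_abs] at this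
      have hpos : 0 ≤ C i * h ^ K * (h⁻¹) ^ (Fintype.card ι) := by
        have := hC i; positivity
      have h2 : |b.repr θ i| ≤ 1 := by rw [abs_of_nonneg hri.1]; exact hri.2.le
      rw [add_comm (b.repr θ i • b i) w]
      calc _ ≤ |psum b g h (w + b.repr θ i • b i) - psum b g h w| + |psum b g h w - psum b g h 0| :=
            abs_sub_le _ _ _
        _ ≤ C i * h ^ K * (h⁻¹) ^ (Fintype.card ι) +
            (∑ i ∈ S, C i) * h ^ K * (h⁻¹) ^ (Fintype.card ι) := by
              refine add_le_add (this.trans ?_) ih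
              nlinarith
        _ = _ := by ring
  have := key Finset.univ
  rwa [b.sum_repr] at this

theorem lattice_smooth (b : Basis ι ℝ V) [MeasurableSpace V] [BorelSpace V] (μ : Measure V)
    [μ.IsAddHaarMeasure] {g : V → ℝ} (hg : ContDiff ℝ (⊤ : ℕ∞) g)
    (hc : HasCompactSupport g) (K : ℕ) : ∃ C : ℝ, 0 ≤ C ∧ ∀ h : ℝ, 0 < h → h ≤ 1 →
      |psum b g h 0 * μ.real (ZSpan.fundamentalDomain b) - (h⁻¹) ^ (Fintype.card ι) * ∫ v, g v ∂μ| ≤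
        C * h ^ K * (h⁻¹) ^ (Fintype.card ι) := by
  obtain ⟨C, hC, hb⟩ := psum_move b hg hc K
  obtain ⟨R, hR, hgR⟩ := exists_radius hc
  set D := ZSpan.fundamentalDomain b with hD
  have hDb : Bornology.IsBounded D := ZSpan.fundamentalDomain_isBounded b
  obtain ⟨r, hr⟩ := hDb.exists_norm_le
  have hDm : μ D ≠ ⊤ := hDb.measure_lt_top.ne
  refine ⟨C * μ.real D, by positivity, fun h h0 h1 => ?_⟩
  obtain ⟨C', -, hS⟩ := lattice_count b (R + max r 0) (by positivity)
  obtain ⟨S, hS1, -⟩ := hS h h0 h1 0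
  have hSall : ∀ θ ∈ D, ∀ ℓ : lat b, ‖h • ((ℓ : V) + θ)‖ ≤ R → ℓ ∈ S := by
    intro θ hθ ℓ hℓ
    apply hS1
    have e : h • ((ℓ : V) + 0) = h • ((ℓ : V) + θ) - h • θ := by rw [← smul_sub]; simp
    rw [e]
    refine (norm_sub_le _ _).trans (add_le_add hℓ ?_)
    rw [norm_smul, Real.norm_eq_abs, abs_of_pos h0]
    have := hr θ hθ
    have h3 := le_max_left r 0
    nlinarith [norm_nonneg θ]
  have hgc := hg.continuous
  have h_integ : Integrable (fun v => g (h • v)) μ := by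
    apply Continuous.integrable_of_hasCompactSupport (by fun_prop)
    exact hc.comp_smul h0.ne'
  haveI : VAddInvariantMeasure (lat b) V μ :=
    ⟨fun c s _ => measure_preimage_add μ (c : V) s⟩
  have hunf : ∫ v, g (h • v) ∂μ = ∫ θ in D, psum b g h θ ∂μ := by
    rw [(ZSpan.isAddFundamentalDomain b μ).integral_eq_tsum'' _ h_integ]
    rw [tsum_eq_sum (s := S)]
    · rw [← integral_finsetSum]
      · apply setIntegral_congr_fun (ZSpan.fundamentalDomain_measurableSet b)
        intro θ hθ
        simp only
        rw [psum_eq_sum b hgR (hSall θ hθ)]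
        rfl
      · intro ℓ _
        exact (h_integ.comp_add_left (ℓ : V)).integrableOn
    · intro ℓ hℓ
      rw [setIntegral_congr_fun (g := fun _ => (0 : ℝ)) (ZSpan.fundamentalDomain_measurableSet b)]
      · simp
      · intro θ hθ
        apply hgR
        by_contra hcon
        exact hℓ (hSall θ hθ ℓ (not_lt.mp hcon))
  have hscale : ∫ v, g (h • v) ∂μ = (h⁻¹) ^ (Fintype.card ι) * ∫ v, g v ∂μ := by
    rw [Measure.integral_comp_smul, Module.finrank_eq_card_basis b, smul_eq_mul, ← inv_pow,
      abs_of_pos (by positivity)]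
  rw [← hscale, hunf]
  have hpi : IntegrableOn (fun θ => psum b g h θ) D μ := by
    have : IntegrableOn (fun θ => ∑ ℓ ∈ S, g (h • ((ℓ : V) + θ))) D μ := by
      apply integrable_finsetSum
      intro ℓ _
      exact (h_integ.comp_add_left (ℓ : V)).integrableOn
    refine this.congr_fun (fun θ hθ => ?_) (ZSpan.fundamentalDomain_measurableSet b)
    exact (psum_eq_sum b hgR (hSall θ hθ)).symm
  have hconst : psum b g h 0 * μ.real D = ∫ θ in D, psum b g h 0 ∂μ := by
    rw [setIntegral_const, smul_eq_mul, mul_comm]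
  have hci : Integrable (fun _ : V => psum b g h 0) (μ.restrict D) :=
    integrableOn_const (hs := hDm)
  rw [hconst, ← integral_sub hci hpi, ← Real.norm_eq_abs]
  have := norm_setIntegral_le_of_norm_le_const (μ := μ) (s := D)
    (f := fun θ => psum b g h 0 - psum b g h θ)
    (C := C * h ^ K * (h⁻¹) ^ (Fintype.card ι)) hDb.measure_lt_top
    (fun θ hθ => by
      rw [norm_sub_rev]
      exact hb h h0 h1 θ hθ)
  refine this.trans (le_of_eq ?_)
  ring

end Lattice
end PrimesInClasses

namespace PrimesInClasses

section Bt

/-- smooth partition of unity on the circle -/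
noncomputable def bt (t : ℝ) : ℝ := Real.smoothTransition (t + 1) - Real.smoothTransition t

lemma bt_contDiff : ContDiff ℝ (⊤ : ℕ∞) bt := by
  unfold bt
  exact (Real.smoothTransition.contDiff.comp (contDiff_id.add contDiff_const)).sub
    Real.smoothTransition.contDiff

lemma bt_eq_zero {t : ℝ} (h : 1 ≤ |t|) : bt t = 0 := by
  unfold bt
  rcases le_abs.mp h with h | h
  · rw [Real.smoothTransition.one_of_one_le h, Real.smoothTransition.one_of_one_le (by linarith),
      sub_self]
  · rw [Real.smoothTransition.zero_of_nonpos (by linarith),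
      Real.smoothTransition.zero_of_nonpos (by linarith), sub_self]

lemma bt_sum_range (c : ℝ) : bt (c + (-⌊c⌋ - 1 : ℤ)) + bt (c + (-⌊c⌋ : ℤ)) = 1 := by
  unfold bt
  have h1 := Int.floor_le c
  have h2 := Int.lt_floor_add_one c
  push_cast
  rw [Real.smoothTransition.one_of_one_le (x := c + -(⌊c⌋ : ℝ) + 1) (by linarith),
    Real.smoothTransition.zero_of_nonpos (x := c + (-(⌊c⌋ : ℝ) - 1)) (by linarith)]
  have : c + (-(⌊c⌋ : ℝ) - 1) + 1 = c + -(⌊c⌋ : ℝ) := by ring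
  rw [this]; ring

lemma bt_support (c : ℝ) (k : ℤ) (hk : k ∉ ({-⌊c⌋ - 1, -⌊c⌋} : Finset ℤ)) : bt (c + k) = 0 := by
  apply bt_eq_zero
  have h1 := Int.floor_le c
  have h2 := Int.lt_floor_add_one c
  simp only [Finset.mem_insert, Finset.mem_singleton, not_or] at hk
  rcases lt_or_ge k (-⌊c⌋ - 1) with h | h
  · have : (k : ℝ) ≤ -⌊c⌋ - 2 := by exact_mod_cast (by omega : k ≤ -⌊c⌋ - 2)
    rw [le_abs]; right; linarith
  · have : (-⌊c⌋ + 1 : ℝ) ≤ k := by exact_mod_cast (by omega : -⌊c⌋ + 1 ≤ k)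
    rw [le_abs]; left; linarith

lemma bt_prod_hasSum {ι : Type*} [Fintype ι] (c : ι → ℝ) :
    HasSum (fun k : ι → ℤ => ∏ i, bt (c i + k i)) 1 := by
  classical
  have h1 : (∏ i, ∑ k ∈ ({-⌊c i⌋ - 1, -⌊c i⌋} : Finset ℤ), bt (c i + k)) = 1 := by
    apply Finset.prod_eq_one
    intro i _
    rw [Finset.sum_pair (by omega)]
    exact bt_sum_range (c i)
  rw [Finset.prod_univ_sum] at h1
  rw [← h1]
  apply hasSum_sum_of_ne_finset_zero
  intro k hk
  rw [Fintype.mem_piFinset] at hk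
  push Not at hk
  obtain ⟨i, hi⟩ := hk
  exact Finset.prod_eq_zero (Finset.mem_univ i) (bt_support _ _ hi)

lemma hasSum_const_prod {T β : Type*} [Finite T] (c : ℝ) {f : β → ℝ} (hf : HasSum f 1) :
    HasSum (fun p : T × β => c * f p.2) (Nat.card T * c) := by
  have := Fintype.ofFinite T
  rw [Nat.card_eq_fintype_card]
  have h1 : HasSum (fun _ : T => c) (Fintype.card T * c) := by
    have := hasSum_fintype (fun _ : T => c)
    simpa using this
  have h2 := h1.mul hf (summable_mul_of_summable_norm (f := fun _ : T => c)
    (hasSum_fintype _).summable hf.summable.norm)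
  simpa using h2

end Bt

section UnitSum

open NumberField.Units NumberField.Units.dirichletUnitTheorem NumberField.mixedEmbedding
  NumberField.mixedEmbedding.fundamentalCone Module

variable (K : Type*) [Field K] [NumberField K]

open scoped Classical in
/-- real basis of the log space coming from the fundamental units -/
noncomputable def bl : Basis (Fin (rank K)) ℝ (logSpace K) :=
  (basisUnitLattice K).ofZLatticeBasis ℝ (unitLattice K)

/-- the smooth weight on the mixed space -/
noncomputable def GG (φ : ℝ → ℝ) (v : mixedSpace K) : ℝ :=
  φ (mixedEmbedding.norm v) * ∏ i, bt ((bl K).repr (logMap v) i)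

lemma bl_repr_log (ζ : torsion K) (e : Fin (rank K) → ℤ) (i : Fin (rank K)) :
    (bl K).repr (logEmbedding K (Additive.ofMul ((ζ : (𝓞 K)ˣ) * ∏ i, (fundSystem K i) ^ (e i)))) i
      = e i := by
  have h1 : logEmbedding K (Additive.ofMul ((ζ : (𝓞 K)ˣ) * ∏ i, (fundSystem K i) ^ (e i)))
      = ∑ i, (e i : ℝ) • bl K i := by
    rw [ofMul_mul, map_add, (logEmbedding_eq_zero_iff).mpr ζ.2, zero_add, ofMul_prod, map_sum]
    refine Finset.sum_congr rfl fun j _ => ?_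
    rw [ofMul_zpow, map_zsmul, logEmbedding_fundSystem, bl, Basis.ofZLatticeBasis_apply]
    rw [Int.cast_smul_eq_zsmul]
  rw [h1]
  simp [Finsupp.single_apply]

variable {K}

variable (K) in
/-- Dirichlet's unit theorem as a parametrisation. -/
noncomputable def unitPar (p : torsion K × (Fin (rank K) → ℤ)) : (𝓞 K)ˣ :=
  (p.1 : (𝓞 K)ˣ) * ∏ i, (fundSystem K i) ^ (p.2 i)

lemma unitPar_bij : Function.Bijective (unitPar K) := by
  rw [Function.bijective_iff_existsUnique]
  intro u
  obtain ⟨p, hp, hu⟩ := exist_unique_eq_mul_prod K u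
  exact ⟨p, hp.symm, fun y hy => hu y hy.symm⟩

lemma GG_unitPar (φ : ℝ → ℝ) (v : mixedSpace K) (hv : mixedEmbedding.norm v ≠ 0)
    (p : torsion K × (Fin (rank K) → ℤ)) :
    GG K φ (unitPar K p • v) =
      φ (mixedEmbedding.norm v) * ∏ i, bt ((bl K).repr (logMap v) i + p.2 i) := by
  rw [GG, norm_unit_smul]
  congr 1
  refine Finset.prod_congr rfl fun i _ => ?_
  rw [logMap_unit_smul _ hv, map_add, Finsupp.add_apply, unitPar, bl_repr_log, add_comm]

lemma GG_unit_hasSum (φ : ℝ → ℝ) (v : mixedSpace K) (hv : mixedEmbedding.norm v ≠ 0) :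
    HasSum (fun u : (𝓞 K)ˣ => GG K φ (u • v)) (torsionOrder K * φ (mixedEmbedding.norm v)) := by
  have h1 := hasSum_const_prod (T := torsion K) (φ (mixedEmbedding.norm v))
    (bt_prod_hasSum (fun i => (bl K).repr (logMap v) i))
  have h2 : (fun p : torsion K × (Fin (rank K) → ℤ) => φ (mixedEmbedding.norm v) *
      ∏ i, bt ((bl K).repr (logMap v) i + p.2 i)) =
      (fun u : (𝓞 K)ˣ => GG K φ (u • v)) ∘ (Equiv.ofBijective (unitPar K) unitPar_bij) := by
    funext p
    exact (GG_unitPar φ v hv p).symm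
  rw [h2, Equiv.hasSum_iff] at h1
  exact h1

end UnitSum
end PrimesInClasses

namespace PrimesInClasses

section Smooth

open scoped Classical

open NumberField.Units NumberField.Units.dirichletUnitTheorem NumberField.mixedEmbedding
  NumberField.mixedEmbedding.fundamentalCone Module NumberField.InfinitePlace

variable {K : Type*} [Field K] [NumberField K]

lemma contDiffAt_normAtPlace (w : InfinitePlace K) (v : mixedSpace K) (hv : normAtPlace w v ≠ 0) :
    ContDiffAt ℝ (⊤ : ℕ∞) (fun v : mixedSpace K => normAtPlace w v) v := by
  by_cases hw : IsReal w
  · simp only [normAtPlace_apply_of_isReal hw] at hv ⊢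
    have h : ContDiff ℝ (⊤ : ℕ∞) (fun x : mixedSpace K => x.1 ⟨w, hw⟩) := by fun_prop
    exact (h.contDiffAt).norm ℝ (by simpa using hv)
  · rw [not_isReal_iff_isComplex] at hw
    simp only [normAtPlace_apply_of_isComplex hw] at hv ⊢
    have h : ContDiff ℝ (⊤ : ℕ∞) (fun x : mixedSpace K => x.2 ⟨w, hw⟩) := by fun_prop
    exact (h.contDiffAt).norm ℝ (by simpa using hv)

lemma GG_support {φ : ℝ → ℝ} (hφ : ∀ t, t ∉ Set.Icc (1/2 : ℝ) 1 → φ t = 0) :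
    ∃ A : ℝ, ∀ v : mixedSpace K, GG K φ v ≠ 0 → ∀ w : InfinitePlace K,
      0 < normAtPlace w v ∧ |Real.log (normAtPlace w v)| ≤ A := by

  let c : ℝ := ∑ i, ‖bl K i‖
  have hc0 : 0 ≤ c := Finset.sum_nonneg fun _ _ => norm_nonneg _
  let A : ℝ := c + Real.log 2
  have hl2 : 0 ≤ Real.log 2 := Real.log_nonneg (by norm_num)
  have hA : 0 ≤ A := by positivity
  let N : ℝ := ∑ w : InfinitePlace K, (w.mult : ℝ)
  have hN : 0 ≤ N := Finset.sum_nonneg fun _ _ => by positivity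
  refine ⟨Real.log 2 + N * A + A, fun v hv => ?_⟩
  have h1 : φ (mixedEmbedding.norm v) ≠ 0 := fun h => hv (by simp [GG, h])
  have h2 : ∀ i, bt ((bl K).repr (logMap v) i) ≠ 0 := fun i h => hv (by
    rw [GG, Finset.prod_eq_zero (Finset.mem_univ i) h, mul_zero])
  have h3 : mixedEmbedding.norm v ∈ Set.Icc (1/2 : ℝ) 1 := by
    by_contra h; exact h1 (hφ _ h)
  have h4 : ∀ i, |(bl K).repr (logMap v) i| ≤ 1 := by
    intro i; by_contra h; exact h2 i (bt_eq_zero (not_le.mp h).le)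
  have hn0 : mixedEmbedding.norm v ≠ 0 := by have := h3.1; intro h; rw [h] at this; norm_num at this
  have hpos : ∀ w, 0 < normAtPlace w v := fun w =>
    lt_of_le_of_ne (normAtPlace_nonneg w v) ((mixedEmbedding.norm_ne_zero_iff.mp hn0 w).symm)
  have h5 : ‖logMap v‖ ≤ c := by
    conv_lhs => rw [← (bl K).sum_repr (logMap v)]
    refine (norm_sum_le _ _).trans (Finset.sum_le_sum fun i _ => ?_)
    rw [_root_.norm_smul, Real.norm_eq_abs]
    exact mul_le_of_le_one_left (norm_nonneg _) (h4 i)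
  have h6 : |Real.log (mixedEmbedding.norm v)| ≤ Real.log 2 := by
    rw [abs_le]
    constructor
    · rw [← Real.log_inv]; exact Real.log_le_log (by norm_num) (by have := h3.1; norm_num at this ⊢; linarith)
    · exact (Real.log_nonpos (by linarith [h3.1]) h3.2).trans hl2
  have h7 : ∀ w : {w : InfinitePlace K // w ≠ w₀}, |Real.log (normAtPlace w.1 v)| ≤ A := by
    intro w
    have e1 := (norm_le_pi_norm (logMap v) w).trans h5
    rw [logMap_apply, Real.norm_eq_abs, abs_mul] at e1
    have e2 : (1 : ℝ) ≤ |(w.1.mult : ℝ)| := by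
      rw [abs_of_nonneg (by positivity)]; exact_mod_cast w.1.mult_pos
    have e3 := (le_mul_of_one_le_left (abs_nonneg _) e2).trans e1
    have e4 : |Real.log (mixedEmbedding.norm v) * (finrank ℚ K : ℝ)⁻¹| ≤ Real.log 2 := by
      rw [abs_mul]
      refine (mul_le_of_le_one_right (abs_nonneg _) ?_).trans h6
      rw [abs_of_nonneg (by positivity)]
      apply inv_le_one_of_one_le₀
      exact_mod_cast finrank_pos (R := ℚ) (M := K)
    rw [abs_le] at e3 e4 ⊢
    constructor <;> simp only [A] <;> linarith [e3.1, e3.2, e4.1, e4.2]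
  intro w
  refine ⟨hpos w, ?_⟩
  have hNA : 0 ≤ N * A := mul_nonneg hN hA
  by_cases hw : w = w₀
  · subst hw
    have e1 : Real.log (mixedEmbedding.norm v) =
        ∑ w : InfinitePlace K, (w.mult : ℝ) * Real.log (normAtPlace w v) := by
      rw [mixedEmbedding.norm_apply, Real.log_prod (fun w _ => (pow_pos (hpos w) _).ne')]
      simp [Real.log_pow]
    rw [← Finset.add_sum_erase _ _ (Finset.mem_univ (w₀ : InfinitePlace K))] at e1
    have e2 : |∑ w ∈ Finset.univ.erase (w₀ : InfinitePlace K),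
        (w.mult : ℝ) * Real.log (normAtPlace w v)| ≤ N * A := by
      refine (Finset.abs_sum_le_sum_abs _ _).trans ?_
      simp only [N]
      rw [Finset.sum_mul]
      refine (Finset.sum_le_sum (g := fun w : InfinitePlace K => (w.mult : ℝ) * A)
        fun w hw => ?_).trans
        (Finset.sum_le_sum_of_subset_of_nonneg (Finset.erase_subset _ _)
          fun _ _ _ => by positivity)
      rw [abs_mul, abs_of_nonneg (by positivity : (0 : ℝ) ≤ (w.mult : ℝ))]
      gcongr
      exact h7 ⟨w, Finset.ne_of_mem_erase hw⟩
    have e3 : |((w₀ : InfinitePlace K).mult : ℝ) * Real.log (normAtPlace w₀ v)|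
        ≤ Real.log 2 + N * A := by
      have : ((w₀ : InfinitePlace K).mult : ℝ) * Real.log (normAtPlace w₀ v) =
        Real.log (mixedEmbedding.norm v) - ∑ w ∈ Finset.univ.erase (w₀ : InfinitePlace K),
        (w.mult : ℝ) * Real.log (normAtPlace w v) := by rw [e1]; ring
      rw [this]
      refine (abs_sub _ _).trans (add_le_add h6 e2)
    rw [abs_mul] at e3
    have e4 : (1 : ℝ) ≤ |((w₀ : InfinitePlace K).mult : ℝ)| := by
      rw [abs_of_nonneg (by positivity)]; exact_mod_cast (w₀ : InfinitePlace K).mult_pos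
    linarith [le_mul_of_one_le_left (abs_nonneg (Real.log (normAtPlace w₀ v))) e4]
  · linarith [h7 ⟨w, hw⟩]

lemma GG_contDiff {φ : ℝ → ℝ} (hφs : ContDiff ℝ (⊤ : ℕ∞) φ)
    (hφ : ∀ t, t ∉ Set.Icc (1/2 : ℝ) 1 → φ t = 0) :
    ContDiff ℝ (⊤ : ℕ∞) (GG K φ) := by

  obtain ⟨A, hA⟩ := GG_support (K := K) hφ
  rw [contDiff_iff_contDiffAt]
  intro v
  by_cases hv : ∀ w : InfinitePlace K, normAtPlace w v ≠ 0
  · have hn : ContDiffAt ℝ (⊤ : ℕ∞) (fun v : mixedSpace K => mixedEmbedding.norm v) v := by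
      simp only [mixedEmbedding.norm_apply]
      exact contDiffAt_prod fun w _ => (contDiffAt_normAtPlace w v (hv w)).pow _
    have hn0 : mixedEmbedding.norm v ≠ 0 := mixedEmbedding.norm_ne_zero_iff.mpr hv
    have hlog : ContDiffAt ℝ (⊤ : ℕ∞) (fun v : mixedSpace K => logMap v) v := by
      rw [contDiffAt_pi]
      intro w
      simp only [logMap_apply]
      exact contDiffAt_const.mul (((contDiffAt_normAtPlace w.1 v (hv w.1)).log (hv w.1)).sub
        ((hn.log hn0).mul contDiffAt_const))
    unfold GG
    refine (hφs.contDiffAt.comp v hn).mul (contDiffAt_prod fun i _ => ?_)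
    have hl : ContDiff ℝ (⊤ : ℕ∞) (fun x : logSpace K => (bl K).repr x i) := by
      exact (LinearMap.toContinuousLinearMap ((bl K).coord i)).contDiff
    exact bt_contDiff.contDiffAt.comp v (hl.contDiffAt.comp v hlog)
  · push Not at hv
    obtain ⟨w, hw⟩ := hv
    have hev : ∀ᶠ x in nhds v, normAtPlace w x < Real.exp (-A) := by
      apply (continuous_normAtPlace w).continuousAt.eventually_lt continuousAt_const
      rw [hw]; exact Real.exp_pos _
    have : GG K φ =ᶠ[nhds v] fun _ => 0 := by
      filter_upwards [hev] with x hx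
      by_contra h
      obtain ⟨h1, h2⟩ := hA x h w
      rw [← Real.log_lt_iff_lt_exp h1] at hx
      linarith [(abs_le.mp h2).1]
    exact contDiffAt_const.congr_of_eventuallyEq this

lemma GG_compact {φ : ℝ → ℝ} (hφ : ∀ t, t ∉ Set.Icc (1/2 : ℝ) 1 → φ t = 0) :
    HasCompactSupport (GG K φ) := by
  obtain ⟨A, hA⟩ := GG_support (K := K) hφ
  refine HasCompactSupport.of_support_subset_isCompact
    (isCompact_closedBall (0 : mixedSpace K) (Real.exp A)) fun v hv => ?_
  rw [Metric.mem_closedBall, dist_zero_right, norm_eq_sup'_normAtPlace]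
  refine Finset.sup'_le _ _ fun w _ => ?_
  obtain ⟨h1, h2⟩ := hA v hv w
  rw [← Real.log_le_iff_le_exp h1]
  exact (abs_le.mp h2).2

lemma GG_zero {φ : ℝ → ℝ} (hφ : ∀ t, t ∉ Set.Icc (1/2 : ℝ) 1 → φ t = 0) : GG K φ 0 = 0 := by
  rw [GG, map_zero, hφ 0 (by norm_num), zero_mul]

end Smooth
end PrimesInClasses

namespace PrimesInClasses

section ClassCount

open scoped Classical

open NumberField.Units NumberField.Units.dirichletUnitTheorem NumberField.mixedEmbedding
  NumberField.mixedEmbedding.fundamentalCone Module NumberField.InfinitePlace MeasureTheory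

variable {K : Type*} [Field K] [NumberField K]

/-- integral ideals in a class -/
abbrev IC (C : ClassGroup (𝓞 K)) := {a : (Ideal (𝓞 K))⁰ // ClassGroup.mk0 a = C}

/-- basis of ideal lattice -/
noncomputable abbrev Jb (J : (Ideal (𝓞 K))⁰) := fractionalIdealLatticeBasis K (FractionalIdeal.mk0 K J)

lemma mem_lat_Jb (J : (Ideal (𝓞 K))⁰) (x : mixedSpace K) :
    x ∈ lat (Jb J) ↔ ∃ y : 𝓞 K, y ∈ (J : Ideal (𝓞 K)) ∧ mixedEmbedding K (y : K) = x := by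
  rw [mem_span_fractionalIdealLatticeBasis]
  constructor
  · rintro ⟨z, hz, rfl⟩
    obtain ⟨y, hy, rfl⟩ := (FractionalIdeal.mem_coeIdeal _).mp hz
    exact ⟨y, hy, rfl⟩
  · rintro ⟨y, hy, rfl⟩
    exact ⟨y, (FractionalIdeal.mem_coeIdeal _).mpr ⟨y, hy, rfl⟩, rfl⟩

lemma mk0_eq_one_iff' (I : (Ideal (𝓞 K))⁰) : ClassGroup.mk0 I = 1 ↔
    ∃ γ : 𝓞 K, γ ≠ 0 ∧ Ideal.span {γ} = (I : Ideal (𝓞 K)) := by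
  obtain ⟨I, hI⟩ := I
  rw [ClassGroup.mk0_eq_one_iff hI]
  constructor
  · rintro ⟨γ, hγ⟩
    rw [Ideal.submodule_span_eq] at hγ
    refine ⟨γ, ?_, hγ.symm⟩
    rintro rfl
    rw [Ideal.span_singleton_eq_bot.mpr rfl] at hγ
    exact nonZeroDivisors.ne_zero hI hγ
  · rintro ⟨γ, -, hγ⟩
    exact ⟨γ, hγ.symm⟩

lemma exists_gen {C : ClassGroup (𝓞 K)} {J : (Ideal (𝓞 K))⁰} (hJ : ClassGroup.mk0 J = C⁻¹)
    (a : IC C) : ∃ γ : 𝓞 K, γ ≠ 0 ∧ Ideal.span {γ} = (a.1 : Ideal (𝓞 K)) * J := by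
  have h1 : ClassGroup.mk0 (a.1 * J) = 1 := by rw [map_mul, a.2, hJ, mul_inv_cancel]
  obtain ⟨γ, h, h'⟩ := (mk0_eq_one_iff' _).mp h1
  exact ⟨γ, h, by rw [h', Submonoid.coe_mul]⟩

lemma exists_IC {C : ClassGroup (𝓞 K)} {J : (Ideal (𝓞 K))⁰} (hJ : ClassGroup.mk0 J = C⁻¹)
    (y : 𝓞 K) (hy0 : y ≠ 0) (hy : y ∈ (J : Ideal (𝓞 K))) :
    ∃ a : IC C, (a.1 : Ideal (𝓞 K)) * J = Ideal.span {y} := by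
  obtain ⟨a, ha⟩ : (J : Ideal (𝓞 K)) ∣ Ideal.span {y} := by
    rw [Ideal.dvd_span_singleton]; exact hy
  have ha0 : a ≠ 0 := by
    rintro rfl
    rw [mul_zero] at ha
    exact hy0 (Ideal.span_singleton_eq_bot.mp ha)
  let a' : (Ideal (𝓞 K))⁰ := ⟨a, mem_nonZeroDivisors_of_ne_zero ha0⟩
  have ha' : ClassGroup.mk0 a' = C := by
    have h3 : ClassGroup.mk0 (J * a') = 1 := by
      rw [mk0_eq_one_iff']
      exact ⟨y, hy0, by rw [ha, Submonoid.coe_mul]⟩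
    rw [map_mul, hJ] at h3
    exact (inv_mul_eq_one.mp h3).symm
  exact ⟨⟨a', ha'⟩, by rw [ha, mul_comm]⟩

lemma unit_smul_mem {J : (Ideal (𝓞 K))⁰} {y : 𝓞 K} (hy : y ∈ (J : Ideal (𝓞 K)))
    (u : (𝓞 K)ˣ) : u • mixedEmbedding K (y : K) ∈ lat (Jb J) := by
  rw [mem_lat_Jb]
  exact ⟨u * y, Ideal.mul_mem_left _ _ hy, by rw [unitSMul_smul]; simp⟩

lemma mem_of_span_eq {I J : Ideal (𝓞 K)} {y : 𝓞 K} (h : Ideal.span {y} = I * J) : y ∈ J := by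
  rw [← Ideal.span_singleton_le_iff_mem, h]
  exact Ideal.mul_le_right (I := I) (J := J)

lemma exists_Xi {C : ClassGroup (𝓞 K)} {J : (Ideal (𝓞 K))⁰}
    (hJ : ClassGroup.mk0 J = C⁻¹) : ∃ (γ : IC C → 𝓞 K) (Ξ : IC C × (𝓞 K)ˣ → lat (Jb J)),
      Function.Injective Ξ ∧ (∀ ℓ : lat (Jb J), (ℓ : mixedSpace K) ≠ 0 → ℓ ∈ Set.range Ξ) ∧
      (∀ a u, ((Ξ (a, u) : lat (Jb J)) : mixedSpace K) = u • mixedEmbedding K (γ a : K)) ∧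
      ∀ a, Ideal.span {γ a} = (a.1 : Ideal (𝓞 K)) * J := by
  choose γ hγ0 hγ using exists_gen hJ
  have hmem : ∀ a, γ a ∈ (J : Ideal (𝓞 K)) := by
    intro a
    exact mem_of_span_eq (hγ a)
  have hΞ : ∀ a (u : (𝓞 K)ˣ), u • mixedEmbedding K (γ a : K) =
      mixedEmbedding K ((u * γ a : 𝓞 K) : K) := by
    intro a u; rw [unitSMul_smul]; simp
  refine ⟨γ, fun p => ⟨p.2 • mixedEmbedding K (γ p.1 : K), unit_smul_mem (hmem _) _⟩,
    ?_, ?_, fun _ _ => rfl, hγ⟩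
  · rintro ⟨a, u⟩ ⟨a', u'⟩ he
    have e1 := Subtype.ext_iff.mp he
    simp only [hΞ] at e1
    have e2 : (u * γ a : 𝓞 K) = u' * γ a' :=
      RingOfIntegers.coe_injective (mixedEmbedding_injective K e1)
    have e3 : (a.1 : Ideal (𝓞 K)) * J = (a'.1 : Ideal (𝓞 K)) * J := by
      rw [← hγ, ← hγ, ← Ideal.span_singleton_mul_left_unit u.isUnit, e2,
        Ideal.span_singleton_mul_left_unit u'.isUnit]
    have e4 : a = a' := by
      apply Subtype.ext; apply Subtype.ext
      exact mul_right_cancel₀ (nonZeroDivisors.ne_zero J.2) e3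
    subst e4
    have e5 := mul_right_cancel₀ (hγ0 a) e2
    rw [Units.ext e5]
  · intro ℓ hℓ
    obtain ⟨y, hy, hyℓ⟩ := (mem_lat_Jb J ℓ).mp ℓ.2
    have hy0 : y ≠ 0 := by rintro rfl; apply hℓ; rw [← hyℓ]; simp
    obtain ⟨a, ha⟩ := exists_IC hJ y hy0 hy
    have h4 : Ideal.span {γ a} = Ideal.span {y} := by rw [hγ, ha]
    obtain ⟨u, hu⟩ := Ideal.span_singleton_eq_span_singleton.mp h4
    refine ⟨(a, u), ?_⟩
    apply Subtype.ext
    change u • mixedEmbedding K (γ a : K) = _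
    rw [hΞ, ← hyℓ, ← hu, mul_comm]

lemma psum_hasSum {φ : ℝ → ℝ}
    (hφ : ∀ t, t ∉ Set.Icc (1/2 : ℝ) 1 → φ t = 0) (J : (Ideal (𝓞 K))⁰)
    {h : ℝ} (h0 : 0 < h) (h1 : h ≤ 1) :
    HasSum (fun ℓ : lat (Jb J) => GG K φ (h • ((ℓ : mixedSpace K) + 0)))
      (psum (Jb J) (GG K φ) h 0) := by
  obtain ⟨R, hR, hGR⟩ := exists_radius (GG_compact (K := K) hφ)
  obtain ⟨c, -, hcnt⟩ := lattice_count (Jb J) R hR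
  obtain ⟨S, hS, -⟩ := hcnt h h0 h1 0
  apply Summable.hasSum
  apply summable_of_ne_finset_zero (s := S)
  intro ℓ hℓ
  apply hGR
  by_contra hcon
  exact hℓ (hS ℓ (not_lt.mp hcon))

lemma absNorm_pos (a : (Ideal (𝓞 K))⁰) : (0 : ℝ) < Ideal.absNorm (a : Ideal (𝓞 K)) := by
  rw [Nat.cast_pos, Nat.pos_iff_ne_zero, Ne, Ideal.absNorm_eq_zero_iff]
  exact nonZeroDivisors.ne_zero a.2

lemma norm_gen {a J : (Ideal (𝓞 K))⁰} {γ : 𝓞 K} (hγ : Ideal.span {γ} = (a : Ideal (𝓞 K)) * J)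
    {h : ℝ} (h0 : 0 < h) :
    mixedEmbedding.norm (h • mixedEmbedding K (γ : K)) = h ^ finrank ℚ K *
      (Ideal.absNorm (a : Ideal (𝓞 K)) * Ideal.absNorm (J : Ideal (𝓞 K)) : ℝ) := by
  rw [mixedEmbedding.norm_smul, abs_of_pos h0, norm_eq_norm]
  congr 1
  rw [← Nat.cast_mul, ← map_mul, ← hγ, Ideal.absNorm_span_singleton]
  rw [← Algebra.coe_norm_int]
  simp

lemma class_hasSum {φ : ℝ → ℝ}
    (hφ : ∀ t, t ∉ Set.Icc (1/2 : ℝ) 1 → φ t = 0) {C : ClassGroup (𝓞 K)} {J : (Ideal (𝓞 K))⁰}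
    (hJ : ClassGroup.mk0 J = C⁻¹) {h : ℝ} (h0 : 0 < h) (h1 : h ≤ 1) :
    HasSum (fun a : IC C => (torsionOrder K : ℝ) * φ (h ^ finrank ℚ K *
      (Ideal.absNorm (a.1 : Ideal (𝓞 K)) * Ideal.absNorm (J : Ideal (𝓞 K)) : ℝ)))
      (psum (Jb J) (GG K φ) h 0) := by
  obtain ⟨γ, Ξ, hinj, hrange, hΞ, hγ⟩ := exists_Xi hJ
  have hs1 : HasSum ((fun ℓ : lat (Jb J) => GG K φ (h • ((ℓ : mixedSpace K) + 0))) ∘ Ξ)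
      (psum (Jb J) (GG K φ) h 0) := by
    rw [hinj.hasSum_iff]
    · exact psum_hasSum hφ J h0 h1
    · intro ℓ hℓ
      have : (ℓ : mixedSpace K) = 0 := by
        by_contra hne; exact hℓ (hrange ℓ hne)
      rw [this, add_zero, smul_zero, GG_zero hφ]
  refine HasSum.prod_fiberwise hs1 fun a => ?_
  have hnn := norm_gen (hγ a) h0
  have hne : mixedEmbedding.norm (h • mixedEmbedding K (γ a : K)) ≠ 0 := by
    rw [hnn]
    have e1 := absNorm_pos a.1
    have e2 := absNorm_pos J
    positivity
  rw [← hnn]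
  have h5 := GG_unit_hasSum φ _ hne
  have h6 : (fun u : (𝓞 K)ˣ => GG K φ (u • (h • mixedEmbedding K (γ a : K)))) = fun u =>
     ((fun ℓ : lat (Jb J) => GG K φ (h • ((ℓ : mixedSpace K) + 0))) ∘ Ξ) (a, u) := by
    funext u
    simp only [Function.comp, add_zero, hΞ]
    rw [unitSMul_smul, unitSMul_smul, mul_smul_comm]
  rw [h6] at h5
  exact h5

end ClassCount
end PrimesInClasses

namespace PrimesInClasses

section ClassCount2

open scoped Classical

open NumberField.Units NumberField.Units.dirichletUnitTheorem NumberField.mixedEmbedding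
  NumberField.mixedEmbedding.fundamentalCone Module NumberField.InfinitePlace MeasureTheory

variable {K : Type*} [Field K] [NumberField K]

lemma card_Jb (J : (Ideal (𝓞 K))⁰) :
    Fintype.card (Free.ChooseBasisIndex ℤ (FractionalIdeal.mk0 K J)) = finrank ℚ K := by
  rw [← mixedEmbedding.finrank, finrank_eq_card_basis (Jb J)]

lemma vol_Jb (J : (Ideal (𝓞 K))⁰) :
    (volume : Measure (mixedSpace K)).real (ZSpan.fundamentalDomain (Jb J)) =
      Ideal.absNorm (J : Ideal (𝓞 K)) *
        (volume : Measure (mixedSpace K)).real (ZSpan.fundamentalDomain (latticeBasis K)) := by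
  rw [measureReal_def, measureReal_def, volume_fundamentalDomain_fractionalIdealLatticeBasis,
    ENNReal.toReal_mul, ENNReal.toReal_ofReal (by exact_mod_cast FractionalIdeal.absNorm_nonneg _)]
  congr 1
  rw [FractionalIdeal.coe_mk0, FractionalIdeal.coeIdeal_absNorm]
  simp

lemma vol_pos :
    0 < (volume : Measure (mixedSpace K)).real (ZSpan.fundamentalDomain (latticeBasis K)) := by
  rw [measureReal_def]
  apply ENNReal.toReal_pos
  · exact ZSpan.measure_fundamentalDomain_ne_zero (latticeBasis K)
  · exact (ZSpan.fundamentalDomain_isBounded (latticeBasis K)).measure_lt_top.ne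

variable (K) in
/-- the common density constant -/
noncomputable def kap (φ : ℝ → ℝ) : ℝ := (∫ v, GG K φ v) / (torsionOrder K *
  (volume : Measure (mixedSpace K)).real (ZSpan.fundamentalDomain (latticeBasis K)))

theorem class_count {φ : ℝ → ℝ} (hφs : ContDiff ℝ (⊤ : ℕ∞) φ)
    (hφ : ∀ t, t ∉ Set.Icc (1/2 : ℝ) 1 → φ t = 0) (C : ClassGroup (𝓞 K)) :
    ∃ B : ℝ, 0 ≤ B ∧ ∀ x : ℝ, 1 ≤ x → ∃ S : ℝ,
      HasSum (fun a : IC C => φ (Ideal.absNorm (a.1 : Ideal (𝓞 K)) / x)) S ∧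
      |S - kap K φ * x| ≤ B / x ^ 2 := by
  obtain ⟨J, hJ⟩ := ClassGroup.mk0_surjective C⁻¹
  obtain ⟨B, hB, hlat⟩ := lattice_smooth (Jb J) (volume : Measure (mixedSpace K))
    (GG_contDiff (K := K) hφs hφ) (GG_compact hφ) (3 * finrank ℚ K)
  rw [card_Jb, vol_Jb] at hlat
  set D := (volume : Measure (mixedSpace K)).real (ZSpan.fundamentalDomain (latticeBasis K)) with hDdef
  have hD : 0 < D := vol_pos
  set N : ℝ := (Ideal.absNorm (J : Ideal (𝓞 K)) : ℝ) with hNdef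
  have hN : 1 ≤ N := by
    have := absNorm_pos J
    rw [hNdef]; rw [Nat.cast_pos] at this
    exact_mod_cast this
  set w : ℝ := (torsionOrder K : ℝ) with hwdef
  have hw : 0 < w := by rw [hwdef]; exact_mod_cast torsionOrder_pos K
  set n := finrank ℚ K with hn
  have hn0 : n ≠ 0 := (finrank_pos (R := ℚ) (M := K)).ne'
  refine ⟨B / (w * D), by positivity, fun x hx => ?_⟩
  have hxN : 1 ≤ x * N := by nlinarith
  have hxN0 : 0 < x * N := by linarith
  obtain ⟨h, h0, h1, hpow⟩ : ∃ h : ℝ, 0 < h ∧ h ≤ 1 ∧ h ^ n = (x * N)⁻¹ := by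
    refine ⟨(x * N)⁻¹ ^ ((n : ℝ)⁻¹), by positivity, ?_, ?_⟩
    · exact Real.rpow_le_one (by positivity) (inv_le_one_of_one_le₀ hxN) (by positivity)
    · exact Real.rpow_inv_natCast_pow (by positivity) hn0
  have hs := (class_hasSum hφ hJ h0 h1).mul_left w⁻¹
  have hfun : (fun a : IC C => w⁻¹ * (w * φ (h ^ n * (Ideal.absNorm (a.1 : Ideal (𝓞 K)) * N)))) =
      fun a : IC C => φ (Ideal.absNorm (a.1 : Ideal (𝓞 K)) / x) := by
    funext a
    rw [inv_mul_cancel_left₀ hw.ne', hpow]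
    congr 1
    field_simp
  rw [hfun] at hs
  refine ⟨_, hs, ?_⟩
  have h2 := hlat h h0 h1
  set P := psum (Jb J) (GG K φ) h 0
  have hinv : (h⁻¹) ^ n = x * N := by rw [inv_pow, hpow, inv_inv]
  have h3n : h ^ (3 * n) = ((x * N)⁻¹) ^ 3 := by rw [mul_comm, pow_mul, hpow]
  rw [hinv, h3n] at h2
  have e1 : w⁻¹ * P - kap K φ * x =
      (P * (N * D) - x * N * ∫ v, GG K φ v) / (w * D * N) := by
    rw [kap, ← hDdef, ← hwdef]
    field_simp
  rw [e1, abs_div, abs_of_pos (by positivity : 0 < w * D * N), div_le_iff₀ (by positivity)]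
  refine h2.trans ?_
  have hx0 : 0 < x := by linarith
  have e2 : B * (x * N)⁻¹ ^ 3 * (x * N) = B / x ^ 2 * (1 / N ^ 2) := by
    field_simp
  have e3 : B / (w * D) / x ^ 2 * (w * D * N) = B / x ^ 2 * N := by
    field_simp
  rw [e2, e3]
  gcongr
  rw [div_le_iff₀ (by positivity)]
  nlinarith [one_le_pow₀ hN (n := 3)]

end ClassCount2
end PrimesInClasses

namespace PrimesInClasses

section IdealCombi

open scoped Classical

variable {K : Type*} [Field K] [NumberField K]

lemma absNorm_ne_zero' {I : Ideal (𝓞 K)} (h : I ≠ 0) : Ideal.absNorm I ≠ 0 := by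
  rw [Ne, Ideal.absNorm_eq_zero_iff]; exact h

variable (K) in
/-- ideals of given nonzero norm -/
noncomputable def fib (n : ℕ) : Finset (Ideal (𝓞 K)) :=
  if n = 0 then ∅ else (Ideal.finite_setOfPred_absNorm_eq (S := 𝓞 K) n).toFinset

lemma mem_fib {n : ℕ} {I : Ideal (𝓞 K)} : I ∈ fib K n ↔ Ideal.absNorm I = n ∧ n ≠ 0 := by
  unfold fib
  split_ifs with h
  · simp [h]
  · simp [h]

lemma mem_fib_self {I : Ideal (𝓞 K)} (h : I ≠ 0) : I ∈ fib K (Ideal.absNorm I) :=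
  mem_fib.2 ⟨rfl, absNorm_ne_zero' h⟩

lemma ne_zero_of_mem_fib {n : ℕ} {I : Ideal (𝓞 K)} (h : I ∈ fib K n) : I ≠ 0 := by
  rintro rfl
  obtain ⟨h1, h2⟩ := mem_fib.1 h
  apply h2
  rw [← h1]; simp

/-- pushforward of a function on ideals to an arithmetic function -/
noncomputable def push (f : Ideal (𝓞 K) → ℂ) : ArithmeticFunction ℂ :=
  ⟨fun n => ∑ I ∈ fib K n, f I, by simp [fib]⟩

lemma push_apply (f : Ideal (𝓞 K) → ℂ) (n : ℕ) : push f n = ∑ I ∈ fib K n, f I := rfl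

/-- factorisations of an ideal -/
noncomputable def fac (I : Ideal (𝓞 K)) : Finset (Ideal (𝓞 K) × Ideal (𝓞 K)) :=
  ((Ideal.absNorm I).divisorsAntidiagonal.biUnion
    fun p => fib K p.1 ×ˢ fib K p.2).filter fun p => p.1 * p.2 = I

lemma mem_fac {I : Ideal (𝓞 K)} (hI : I ≠ 0) {p : Ideal (𝓞 K) × Ideal (𝓞 K)} :
    p ∈ fac I ↔ p.1 * p.2 = I := by
  unfold fac
  rw [Finset.mem_filter]
  constructor
  · exact fun h => h.2
  · intro h
    refine ⟨?_, h⟩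
    have h1 : p.1 ≠ 0 := fun h0 => hI (by rw [← h, h0, zero_mul])
    have h2 : p.2 ≠ 0 := fun h0 => hI (by rw [← h, h0, mul_zero])
    rw [Finset.mem_biUnion]
    refine ⟨(Ideal.absNorm p.1, Ideal.absNorm p.2), ?_, ?_⟩
    · rw [Nat.mem_divisorsAntidiagonal]
      refine ⟨?_, absNorm_ne_zero' hI⟩
      rw [← h, map_mul]
    · rw [Finset.mem_product]
      exact ⟨mem_fib_self h1, mem_fib_self h2⟩

lemma push_mul (f g : Ideal (𝓞 K) → ℂ) (n : ℕ) :
    (push f * push g) n = ∑ I ∈ fib K n, ∑ p ∈ fac I, f p.1 * g p.2 := by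
  rw [ArithmeticFunction.mul_apply]
  simp_rw [push_apply, Finset.sum_mul_sum, ← Finset.sum_product']
  rw [Finset.sum_sigma', Finset.sum_sigma']
  refine Finset.sum_bij' (fun x _ => ⟨x.2.1 * x.2.2, x.2⟩)
    (fun x _ => ⟨(Ideal.absNorm x.2.1, Ideal.absNorm x.2.2), x.2⟩) ?_ ?_ ?_ ?_ ?_
  · rintro ⟨⟨a, b⟩, ⟨I, J⟩⟩ h
    simp only [Finset.mem_sigma, Nat.mem_divisorsAntidiagonal, Finset.mem_product] at h ⊢
    obtain ⟨⟨h1, h2⟩, h3, h4⟩ := h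
    have hI := ne_zero_of_mem_fib h3
    have hJ := ne_zero_of_mem_fib h4
    refine ⟨mem_fib.2 ⟨?_, h2⟩, (mem_fac (mul_ne_zero hI hJ)).2 rfl⟩
    rw [map_mul, (mem_fib.1 h3).1, (mem_fib.1 h4).1, h1]
  · rintro ⟨I, ⟨J, L⟩⟩ h
    simp only [Finset.mem_sigma, Nat.mem_divisorsAntidiagonal, Finset.mem_product] at h ⊢
    have hI := ne_zero_of_mem_fib h.1
    have h2 := (mem_fac hI).1 h.2
    simp only at h2
    have h1 : J ≠ 0 := fun h0 => hI (by rw [← h2, h0, zero_mul])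
    have h3 : L ≠ 0 := fun h0 => hI (by rw [← h2, h0, mul_zero])
    refine ⟨⟨?_, (mem_fib.1 h.1).2⟩, mem_fib_self h1, mem_fib_self h3⟩
    rw [← map_mul, h2, (mem_fib.1 h.1).1]
  · rintro ⟨⟨a, b⟩, ⟨I, J⟩⟩ h
    simp only [Finset.mem_sigma, Nat.mem_divisorsAntidiagonal, Finset.mem_product] at h ⊢
    rw [(mem_fib.1 h.2.1).1, (mem_fib.1 h.2.2).1]
  · rintro ⟨I, ⟨J, L⟩⟩ h
    simp only [Finset.mem_sigma] at h ⊢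
    have hI := ne_zero_of_mem_fib h.1
    have h2 := (mem_fac hI).1 h.2
    simp only at h2
    rw [h2]
  · rintro ⟨⟨a, b⟩, ⟨I, J⟩⟩ h
    rfl

/-- von Mangoldt function on ideals -/
noncomputable def vm (J : Ideal (𝓞 K)) : ℝ :=
  if h : IsPrimePow J then Real.log (Ideal.absNorm h.choose) else 0

lemma prime_eq_of_dvd {P Q : Ideal (𝓞 K)} (hP : Prime P) (hQ : Prime Q) (h : P ∣ Q) : P = Q :=
  associated_iff_eq.1 (hP.associated_of_dvd hQ h)

lemma vm_pow {P : Ideal (𝓞 K)} (hP : Prime P) {k : ℕ} (hk : 0 < k) :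
    vm (P ^ k) = Real.log (Ideal.absNorm P) := by
  have h : IsPrimePow (P ^ k) := ⟨P, k, hP, hk, rfl⟩
  unfold vm
  rw [dif_pos h]
  obtain ⟨j, hQ, hj, he⟩ := h.choose_spec
  have : P = h.choose := by
    apply prime_eq_of_dvd hP hQ
    apply hP.dvd_of_dvd_pow (n := j)
    rw [he]
    exact dvd_pow_self _ hk.ne'
  rw [← this]

lemma vm_eq_zero {J : Ideal (𝓞 K)} (h : ¬ IsPrimePow J) : vm J = 0 := by
  unfold vm; rw [dif_neg h]

lemma vm_nonneg (J : Ideal (𝓞 K)) : 0 ≤ vm J := by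
  unfold vm
  split_ifs
  · exact Real.log_natCast_nonneg _
  · rfl

lemma two_le_absNorm {P : Ideal (𝓞 K)} (hP : Prime P) : 2 ≤ Ideal.absNorm P := by
  have h1 := absNorm_ne_zero' hP.ne_zero
  have h2 : Ideal.absNorm P ≠ 1 := by
    rw [Ne, Ideal.absNorm_eq_one_iff]
    intro h
    exact hP.not_unit (by rw [h, ← Ideal.one_eq_top]; exact isUnit_one)
  omega

/-- divisors of an ideal -/
noncomputable def dv (I : Ideal (𝓞 K)) : Finset (Ideal (𝓞 K)) := (fac I).image Prod.fst

lemma mem_dv {I : Ideal (𝓞 K)} (hI : I ≠ 0) {J : Ideal (𝓞 K)} : J ∈ dv I ↔ J ∣ I := by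
  unfold dv
  rw [Finset.mem_image]
  constructor
  · rintro ⟨p, hp, rfl⟩
    exact ⟨p.2, ((mem_fac hI).1 hp).symm⟩
  · rintro ⟨L, hL⟩
    exact ⟨(J, L), (mem_fac hI).2 hL.symm, rfl⟩

lemma sum_fac {I : Ideal (𝓞 K)} (hI : I ≠ 0) (f : Ideal (𝓞 K) → ℝ) :
    ∑ p ∈ fac I, f p.1 = ∑ J ∈ dv I, f J := by
  unfold dv
  rw [Finset.sum_image]
  rintro ⟨a, b⟩ hp ⟨c, d⟩ hq h
  have h1 := (mem_fac hI).1 hp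
  have h2 := (mem_fac hI).1 hq
  simp only at h h1 h2
  subst h
  have ha : a ≠ 0 := fun h0 => hI (by rw [← h1, h0, zero_mul])
  rw [mul_left_cancel₀ ha (h1.trans h2.symm)]

lemma sum_vm_aux {P I : Ideal (𝓞 K)} (hP : Prime P) (hI : I ≠ 0) :
    ∑ J ∈ dv (P * I), vm J = Real.log (Ideal.absNorm P) + ∑ J ∈ dv I, vm J := by
  have hfin : FiniteMultiplicity P I := FiniteMultiplicity.of_prime_left hP hI
  set v := multiplicity P I with hv
  have hvd : P ^ v ∣ I := pow_multiplicity_dvd P I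
  have hvn : ¬ P ^ (v + 1) ∣ I := hfin.not_pow_dvd_of_multiplicity_lt (Nat.lt_succ_self _)
  have hPI : P * I ≠ 0 := mul_ne_zero hP.ne_zero hI
  have hnot : P ^ (v + 1) ∉ dv I := fun h => hvn ((mem_dv hI).1 h)
  rw [← vm_pow hP (Nat.succ_pos v), ← Finset.sum_insert hnot]
  symm
  apply Finset.sum_subset
  · intro J hJ
    rw [Finset.mem_insert] at hJ
    rw [mem_dv hPI]
    rcases hJ with rfl | hJ
    · rw [pow_succ']; exact mul_dvd_mul_left P hvd
    · exact ((mem_dv hI).1 hJ).trans (dvd_mul_left _ _)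
  · intro J hJ hJ'
    apply vm_eq_zero
    rintro ⟨Q, k, hQ, hk, rfl⟩
    apply hJ'
    rw [Finset.mem_insert]
    have hd := (mem_dv hPI).1 hJ
    by_cases hPQ : Q = P
    · subst hPQ
      obtain ⟨k, rfl⟩ : ∃ j, k = j + 1 := ⟨k - 1, by omega⟩
      by_cases hkv : k = v
      · left; rw [hkv]
      · right
        rw [mem_dv hI]
        rw [pow_succ'] at hd
        have hd' : Q ^ k ∣ I := (mul_dvd_mul_iff_left hP.ne_zero).1 hd
        have : k ≤ v := by
          by_contra hlt
          exact hvn ((pow_dvd_pow Q (by omega)).trans hd')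
        exact (pow_dvd_pow Q (by omega)).trans hvd
    · right
      rw [mem_dv hI]
      rw [mul_comm] at hd
      refine hQ.pow_dvd_of_dvd_mul_right k ?_ hd
      intro h
      exact hPQ (prime_eq_of_dvd hQ hP h)

lemma sum_vm (I : Ideal (𝓞 K)) : I ≠ 0 → ∑ J ∈ dv I, vm J = Real.log (Ideal.absNorm I) := by
  refine UniqueFactorizationMonoid.induction_on_prime I ?_ ?_ ?_
  · intro h; exact absurd rfl h
  · intro x hx hx0
    rw [isUnit_iff_eq_one.1 hx, map_one, Nat.cast_one, Real.log_one]
    apply Finset.sum_eq_zero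
    intro J hJ
    apply vm_eq_zero
    rw [mem_dv one_ne_zero] at hJ
    intro h
    exact h.not_unit (isUnit_of_dvd_one hJ)
  · intro a P ha hP ih _
    rw [sum_vm_aux hP ha, ih ha, map_mul, Nat.cast_mul, Real.log_mul]
    · exact_mod_cast absNorm_ne_zero' hP.ne_zero
    · exact_mod_cast absNorm_ne_zero' ha

/-- character on ideals induced from the class group -/
noncomputable def psi (χ : ClassGroup (𝓞 K) →* ℂ) (I : Ideal (𝓞 K)) : ℂ :=
  if h : I = 0 then 0 else χ (ClassGroup.mk0 ⟨I, mem_nonZeroDivisors_of_ne_zero h⟩)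

lemma psi_of_ne (χ : ClassGroup (𝓞 K) →* ℂ) {I : Ideal (𝓞 K)} (h : I ≠ 0) :
    psi χ I = χ (ClassGroup.mk0 ⟨I, mem_nonZeroDivisors_of_ne_zero h⟩) := by
  unfold psi; rw [dif_neg h]

lemma psi_coe (χ : ClassGroup (𝓞 K) →* ℂ) (I : (Ideal (𝓞 K))⁰) :
    psi χ (I : Ideal (𝓞 K)) = χ (ClassGroup.mk0 I) :=
  psi_of_ne χ (nonZeroDivisors.coe_ne_zero I)

lemma psi_mul (χ : ClassGroup (𝓞 K) →* ℂ) {I J : Ideal (𝓞 K)} (hI : I ≠ 0) (hJ : J ≠ 0) :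
    psi χ (I * J) = psi χ I * psi χ J := by
  rw [psi_of_ne χ hI, psi_of_ne χ hJ, psi_of_ne χ (mul_ne_zero hI hJ), ← map_mul, ← map_mul]
  rfl

lemma norm_chi (χ : ClassGroup (𝓞 K) →* ℂ) (c : ClassGroup (𝓞 K)) : ‖χ c‖ = 1 := by
  have h : χ c ^ Fintype.card (ClassGroup (𝓞 K)) = 1 := by
    rw [← map_pow, pow_card_eq_one, map_one]
  exact Complex.norm_eq_one_of_pow_eq_one h Fintype.card_ne_zero

lemma norm_psi (χ : ClassGroup (𝓞 K) →* ℂ) {I : Ideal (𝓞 K)} (hI : I ≠ 0) : ‖psi χ I‖ = 1 := by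
  rw [psi_of_ne χ hI, norm_chi]

/-- coefficients of the class character L-series -/
noncomputable def aC (χ : ClassGroup (𝓞 K) →* ℂ) : ArithmeticFunction ℂ := push (psi χ)

/-- coefficients of minus its logarithmic derivative -/
noncomputable def LC (χ : ClassGroup (𝓞 K) →* ℂ) : ArithmeticFunction ℂ :=
  push (fun I => psi χ I * vm I)

lemma log_mul_aC (χ : ClassGroup (𝓞 K) →* ℂ) (n : ℕ) :
    (Real.log n : ℂ) * aC χ n = (LC χ * aC χ) n := by
  unfold LC aC
  rw [push_mul, push_apply, Finset.mul_sum]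
  refine Finset.sum_congr rfl fun I hI => ?_
  have hI0 := ne_zero_of_mem_fib hI
  have : ∀ p ∈ fac I, psi χ p.1 * (vm p.1 : ℂ) * psi χ p.2 = psi χ I * ((vm p.1 : ℝ) : ℂ) := by
    intro p hp
    have h := (mem_fac hI0).1 hp
    have h1 : p.1 ≠ 0 := fun h0 => hI0 (by rw [← h, h0, zero_mul])
    have h2 : p.2 ≠ 0 := fun h0 => hI0 (by rw [← h, h0, mul_zero])
    rw [← h, psi_mul χ h1 h2]
    ring
  rw [Finset.sum_congr rfl this, ← Finset.mul_sum, ← Complex.ofReal_sum, sum_fac hI0, sum_vm I hI0,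
    (mem_fib.1 hI).1, mul_comm]

end IdealCombi

end PrimesInClasses

namespace PrimesInClasses

section MellinPart

open Set MeasureTheory Filter Topology Asymptotics

/-- test functions -/
structure TestFn (φ : ℝ → ℝ) : Prop where
  cont : ContDiff ℝ (⊤ : ℕ∞) φ
  supp : ∀ t, t ∉ Icc (1/2 : ℝ) 1 → φ t = 0
  nonneg : ∀ t, 0 ≤ φ t
  pos : 0 < φ (3/4)

lemma exists_testFn : ∃ φ : ℝ → ℝ, TestFn φ := by
  let f : ContDiffBump (3/4 : ℝ) := ⟨1/8, 1/4, by norm_num, by norm_num⟩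
  refine ⟨f, f.contDiff, ?_, fun t => f.nonneg, ?_⟩
  · intro t ht
    apply f.zero_of_le_dist
    change (1/4 : ℝ) ≤ _
    rw [Real.dist_eq]
    by_contra h
    push Not at h
    rw [abs_lt] at h
    exact ht ⟨by linarith [h.1], by linarith [h.2]⟩
  · apply f.pos_of_mem_ball
    rw [Metric.mem_ball, dist_self]
    change (0 : ℝ) < 1/4
    norm_num

variable {φ : ℝ → ℝ}

/-- complexified test function -/
noncomputable def phC (φ : ℝ → ℝ) : ℝ → ℂ := fun t => (φ t : ℂ)

lemma phC_cont (hφ : TestFn φ) : Continuous (phC φ) :=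
  Complex.continuous_ofReal.comp hφ.cont.continuous

lemma bigO_top {f : ℝ → ℂ} (a : ℝ) (h : ∀ t, 1 < t → f t = 0) :
    f =O[atTop] (fun t : ℝ => t ^ (-a)) := by
  apply IsBigO.of_bound 1
  filter_upwards [eventually_gt_atTop 1] with t ht
  rw [h t ht, norm_zero]
  positivity

lemma phC_bigO_top (hφ : TestFn φ) (a : ℝ) : (phC φ) =O[atTop] (fun t : ℝ => t ^ (-a)) := by
  apply bigO_top
  intro t ht
  unfold phC
  rw [hφ.supp t (fun h => not_lt.2 h.2 ht), Complex.ofReal_zero]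

lemma phC_bigO_bot (hφ : TestFn φ) (b : ℝ) : (phC φ) =O[𝓝[>] 0] (fun t : ℝ => t ^ (-b)) := by
  apply IsBigO.of_bound 1
  have : Iio (1/2 : ℝ) ∈ 𝓝[>] (0 : ℝ) := mem_nhdsWithin_of_mem_nhds (Iio_mem_nhds (by norm_num))
  filter_upwards [this, self_mem_nhdsWithin] with t ht ht0
  unfold phC
  rw [hφ.supp t (fun h => not_lt.2 h.1 ht), Complex.ofReal_zero, norm_zero]
  positivity

lemma phC_conv (hφ : TestFn φ) (s : ℂ) : MellinConvergent (phC φ) s :=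
  mellinConvergent_of_isBigO_rpow (a := s.re + 1) (b := s.re - 1)
    ((phC_cont hφ).locallyIntegrable.locallyIntegrableOn _)
    (phC_bigO_top hφ _) (by linarith) (phC_bigO_bot hφ _) (by linarith)

lemma phC_diff (hφ : TestFn φ) : Differentiable ℂ (mellin (phC φ)) := fun s =>
  mellin_differentiableAt_of_isBigO_rpow (a := s.re + 1) (b := s.re - 1)
    ((phC_cont hφ).locallyIntegrable.locallyIntegrableOn _)
    (phC_bigO_top hφ _) (by linarith) (phC_bigO_bot hφ _) (by linarith)

lemma cpow_re_pos {t : ℝ} (ht : t ∈ Icc (1/2 : ℝ) 1) {s : ℂ} (hs : |s.im| < 2) :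
    0 < ((t : ℂ) ^ (s - 1)).re := by
  have ht0 : 0 < t := by linarith [ht.1]
  rw [Complex.cpow_def_of_ne_zero (by exact_mod_cast ht0.ne'), ← Complex.ofReal_log ht0.le,
    Complex.exp_re]
  apply mul_pos (Real.exp_pos _)
  have him : ((Real.log t : ℂ) * (s - 1)).im = Real.log t * s.im := by simp
  rw [him]
  have hl : |Real.log t| ≤ Real.log 2 := by
    rw [abs_le]
    constructor
    · have := Real.log_le_log (by norm_num) ht.1
      rw [one_div, Real.log_inv] at this
      exact this
    · exact (Real.log_nonpos ht0.le ht.2).trans (Real.log_nonneg (by norm_num))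
  have h2 : |Real.log t * s.im| < Real.pi / 2 := by
    rw [abs_mul]
    have := Real.log_two_lt_d9
    have := Real.pi_gt_three
    have := abs_nonneg s.im
    have := abs_nonneg (Real.log t)
    nlinarith
  rw [abs_lt] at h2
  exact Real.cos_pos_of_mem_Ioo h2

lemma mellin_ne_zero (hφ : TestFn φ) {s : ℂ} (hs : |s.im| < 2) : mellin (phC φ) s ≠ 0 := by
  intro h0
  have h_integ := phC_conv hφ s
  have hre : ∫ t in Ioi (0 : ℝ), ((t : ℂ) ^ (s - 1)).re * φ t = 0 := by
    have := Complex.reCLM.integral_comp_comm h_integ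
    unfold mellin at h0
    rw [h0] at this
    simp only [Complex.reCLM_apply, Complex.zero_re] at this
    refine Eq.trans ?_ this
    congr 1
    ext t
    simp [phC]
  have hre_int : IntegrableOn (fun t : ℝ => ((t : ℂ) ^ (s - 1)).re * φ t) (Ioi (0 : ℝ)) := by
    have := Complex.reCLM.integrable_comp h_integ
    refine this.congr (Eventually.of_forall fun t => ?_)
    simp [phC]
  have hpos : ∀ t : ℝ, 0 ≤ ((t : ℂ) ^ (s - 1)).re * φ t := by
    intro t
    by_cases ht : t ∈ Icc (1/2 : ℝ) 1
    · exact mul_nonneg (cpow_re_pos ht hs).le (hφ.nonneg t)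
    · rw [hφ.supp t ht, mul_zero]
  have := (setIntegral_pos_iff_support_of_nonneg_ae (Eventually.of_forall hpos) hre_int).2 (by
    have hopen : IsOpen {t : ℝ | 0 < φ t} := isOpen_lt continuous_const hφ.cont.continuous
    have hne : {t : ℝ | 0 < φ t}.Nonempty := ⟨_, hφ.pos⟩
    refine (hopen.measure_pos volume hne).trans_le (measure_mono ?_)
    intro t ht
    have htI : t ∈ Icc (1/2 : ℝ) 1 := by
      by_contra h
      rw [mem_setOf_eq, hφ.supp t h] at ht
      exact lt_irrefl _ ht
    refine ⟨?_, ?_⟩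
    · rw [Function.mem_support]
      exact (mul_pos (cpow_re_pos htI hs) ht).ne'
    · rw [mem_Ioi]; linarith [htI.1])
  linarith

/-- smoothed summatory function in the variable `1/x` -/
noncomputable def GA (φ : ℝ → ℝ) (a : ℕ → ℂ) (u : ℝ) : ℂ := ∑' n : ℕ, a n * phC φ (n * u)

lemma phC_zero (hφ : TestFn φ) : phC φ 0 = 0 := by
  unfold phC
  rw [hφ.supp 0 (fun h => by have := h.1; norm_num at this), Complex.ofReal_zero]

lemma phC_big (hφ : TestFn φ) {t : ℝ} (ht : 1 < t) : phC φ t = 0 := by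
  unfold phC
  rw [hφ.supp t (fun h => not_lt.2 h.2 ht), Complex.ofReal_zero]

lemma GA_eq_sum (hφ : TestFn φ) (a : ℕ → ℂ) {M : ℕ} {u : ℝ} (hM : 1 < M * u) (hu : 0 < u) :
    GA φ a u = ∑ n ∈ Finset.range M, a n * phC φ (n * u) := by
  unfold GA
  apply tsum_eq_sum
  intro n hn
  rw [Finset.mem_range, not_lt] at hn
  have : (M : ℝ) ≤ n := by exact_mod_cast hn
  rw [phC_big hφ (by nlinarith), mul_zero]

lemma GA_zero (hφ : TestFn φ) (a : ℕ → ℂ) {u : ℝ} (hu : 1 < u) : GA φ a u = 0 := by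
  rw [GA_eq_sum hφ a (M := 1) (by simpa using hu) (by linarith)]
  simp [phC_zero hφ]

lemma GA_cont (hφ : TestFn φ) (a : ℕ → ℂ) : ContinuousOn (GA φ a) (Ioi 0) := by
  intro u hu
  rw [mem_Ioi] at hu
  apply ContinuousAt.continuousWithinAt
  obtain ⟨M, hM⟩ := exists_nat_gt (2 / u)
  rw [div_lt_iff₀ hu] at hM
  have : GA φ a =ᶠ[𝓝 u] fun u => ∑ n ∈ Finset.range M, a n * phC φ (n * u) := by
    filter_upwards [Ioi_mem_nhds (show u / 2 < u by linarith)] with v hv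
    rw [mem_Ioi] at hv
    have : (0 : ℝ) ≤ M := Nat.cast_nonneg M
    exact GA_eq_sum hφ a (by nlinarith) (by linarith)
  rw [continuousAt_congr this]
  apply Continuous.continuousAt
  have := phC_cont hφ
  fun_prop

lemma mellin_GA (hφ : TestFn φ) (a : ℕ → ℂ) {s : ℂ} (hs : LSeriesSummable a s) :
    mellin (GA φ a) s = LSeries a s * mellin (phC φ) s := by
  set F : ℕ → ℝ → ℂ := fun n t => (t : ℂ) ^ (s - 1) • (a n * phC φ (n * t)) with hF
  have hF0 : F 0 = 0 := by
    ext t; simp [hF, phC_zero hφ]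
  have hterm : ∀ n, ∫ t in Ioi (0 : ℝ), F n t = LSeries.term a s n * mellin (phC φ) s := by
    intro n
    rcases Nat.eq_zero_or_pos n with rfl | hn
    · simp [hF0]
    · have h1 := mellin_comp_mul_left (phC φ) s (a := (n : ℝ)) (by exact_mod_cast hn)
      have h2 : ∫ t in Ioi (0 : ℝ), F n t = a n * mellin (fun t => phC φ (n * t)) s := by
        unfold mellin
        rw [← integral_const_mul]
        congr 1
        ext t
        simp only [hF, smul_eq_mul]
        ring
      rw [h2, h1, LSeries.term_of_ne_zero hn.ne', smul_eq_mul, Complex.cpow_neg,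
        Complex.ofReal_natCast]
      ring
  have hInt : ∀ n, Integrable (F n) (volume.restrict (Ioi (0 : ℝ))) := by
    intro n
    rcases Nat.eq_zero_or_pos n with rfl | hn
    · rw [hF0]; exact integrable_zero _ _ _
    · have h1 := (MellinConvergent.comp_mul_left (f := phC φ) (s := s) (a := (n : ℝ))
        (by exact_mod_cast hn)).2 (phC_conv hφ s)
      exact h1.const_smul (a n)
  have hnorm : ∀ n, ∫ t in Ioi (0 : ℝ), ‖F n t‖ =
      ‖LSeries.term a s n‖ * ∫ t in Ioi (0 : ℝ), ‖(t : ℂ) ^ (s - 1) • phC φ t‖ := by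
    intro n
    rcases Nat.eq_zero_or_pos n with rfl | hn
    · simp [hF0]
    · have hn' : (0 : ℝ) < n := by exact_mod_cast hn
      have hc := integral_comp_mul_left_Ioi (fun t : ℝ => ‖(t : ℂ) ^ (s - 1) • phC φ t‖) 0 hn'
      rw [mul_zero] at hc
      have : ∀ t ∈ Ioi (0 : ℝ), ‖F n t‖ = (‖a n‖ * (n : ℝ) ^ (1 - s.re)) *
          ‖((n * t : ℝ) : ℂ) ^ (s - 1) • phC φ (n * t)‖ := by
        intro t ht
        rw [mem_Ioi] at ht
        simp only [hF, smul_eq_mul, norm_mul]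
        rw [Complex.norm_cpow_eq_rpow_re_of_pos ht,
          Complex.norm_cpow_eq_rpow_re_of_pos (mul_pos hn' ht), Real.mul_rpow hn'.le ht.le]
        have : (n : ℝ) ^ (1 - s.re) * (n : ℝ) ^ ((s - 1).re) = 1 := by
          rw [← Real.rpow_add hn']; simp
        linear_combination (-‖a n‖ * t ^ ((s - 1).re) * ‖phC φ (n * t)‖) * this
      rw [setIntegral_congr_fun measurableSet_Ioi this, integral_const_mul, hc,
        LSeries.norm_term_eq, if_neg hn.ne', smul_eq_mul, ← mul_assoc]
      congr 1
      rw [Real.rpow_sub hn', Real.rpow_one]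
      field_simp
  have hsum : Summable fun n => ∫ t in Ioi (0 : ℝ), ‖F n t‖ := by
    simp_rw [hnorm]
    exact (Summable.norm hs).mul_right _
  have key := hasSum_integral_of_summable_integral_norm hInt hsum
  simp_rw [hterm] at key
  have k2 : HasSum (fun n => LSeries.term a s n * mellin (phC φ) s)
      (LSeries a s * mellin (phC φ) s) := (Summable.hasSum hs).mul_right _
  rw [k2.unique key]
  unfold mellin
  congr 1
  ext t
  simp only [hF, smul_eq_mul, GA]
  rw [tsum_mul_left]

/-- error term -/
noncomputable def EA (φ : ℝ → ℝ) (a : ℕ → ℂ) (κ : ℂ) (u : ℝ) : ℂ :=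
  GA φ a u - κ • (Ioc (0 : ℝ) 1).indicator (fun t : ℝ => (t : ℂ) ^ (-1 : ℂ)) u

lemma ind_locInt : LocallyIntegrableOn
    ((Ioc (0 : ℝ) 1).indicator (fun t : ℝ => (t : ℂ) ^ (-1 : ℂ))) (Ioi 0) := by
  have h1 : LocallyIntegrableOn (fun t : ℝ => (t : ℂ) ^ (-1 : ℂ)) (Ioi 0) := by
    apply ContinuousOn.locallyIntegrableOn _ measurableSet_Ioi
    intro t ht
    apply ContinuousAt.continuousWithinAt
    exact Complex.continuousAt_ofReal_cpow_const _ _ (Or.inr (ne_of_gt ht))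
  intro x hx
  obtain ⟨U, hU, hi⟩ := h1 x hx
  exact ⟨U, hU, Integrable.indicator hi measurableSet_Ioc⟩

lemma EA_locInt (hφ : TestFn φ) (a : ℕ → ℂ) (κ : ℂ) : LocallyIntegrableOn (EA φ a κ) (Ioi 0) := by
  have h1 := (GA_cont hφ a).locallyIntegrableOn measurableSet_Ioi (μ := volume)
  have h2 : LocallyIntegrableOn (fun u => κ • (Ioc (0 : ℝ) 1).indicator
      (fun t : ℝ => (t : ℂ) ^ (-1 : ℂ)) u) (Ioi 0) := by
    intro x hx
    obtain ⟨U, hU, hi⟩ := ind_locInt x hx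
    exact ⟨U, hU, Integrable.smul κ hi⟩
  exact h1.sub h2

lemma EA_zero (hφ : TestFn φ) (a : ℕ → ℂ) (κ : ℂ) {u : ℝ} (hu : 1 < u) : EA φ a κ u = 0 := by
  unfold EA
  rw [GA_zero hφ a hu, indicator_of_notMem (fun h => not_lt.2 h.2 hu)]
  simp

theorem mellin_cont (hφ : TestFn φ) (a : ℕ → ℂ) (κ : ℂ) (B : ℝ)
    (hsum : ∀ s : ℂ, 1 < s.re → LSeriesSummable a s)
    (hA : ∀ x : ℝ, 1 ≤ x → ∃ S : ℂ, HasSum (fun n : ℕ => a n * (φ (n / x) : ℂ)) S ∧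
      ‖S - κ * x‖ ≤ B / x ^ 2) :
    ∃ F m : ℂ → ℂ, DifferentiableOn ℂ F (Metric.ball (3/2) 2) ∧
      DifferentiableOn ℂ m (Metric.ball (3/2) 2) ∧
      ∀ s ∈ Metric.ball (3/2 : ℂ) 2, 1 < s.re → LSeries a s = F s + κ / (s - 1) * m s := by
  have hball : ∀ s ∈ Metric.ball (3/2 : ℂ) 2, |s.im| < 2 ∧ -2 < s.re := by
    intro s hs
    rw [Metric.mem_ball, Complex.dist_eq] at hs
    have h1 := (Complex.abs_im_le_norm (s - 3/2)).trans_lt hs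
    have h2 := (Complex.abs_re_le_norm (s - 3/2)).trans_lt hs
    have e1 : (s - 3/2 : ℂ).im = s.im := by
      rw [Complex.sub_im]; norm_num
    have e2 : (s - 3/2 : ℂ).re = s.re - 3/2 := by
      rw [Complex.sub_re]; norm_num
    rw [e1] at h1
    rw [e2, abs_lt] at h2
    exact ⟨h1, by linarith⟩
  have hEbot : (EA φ a κ) =O[𝓝[>] 0] (fun t : ℝ => t ^ (-(-2 : ℝ))) := by
    apply IsBigO.of_bound B
    have : Iic (1 : ℝ) ∈ 𝓝[>] (0 : ℝ) := mem_nhdsWithin_of_mem_nhds (Iic_mem_nhds (by norm_num))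
    filter_upwards [this, self_mem_nhdsWithin] with t ht ht0
    rw [mem_Iic] at ht
    rw [mem_Ioi] at ht0
    obtain ⟨S, hS, hb⟩ := hA t⁻¹ ((one_le_inv₀ ht0).2 ht)
    have hG : GA φ a t = S := by
      rw [← hS.tsum_eq]
      unfold GA phC
      simp
    unfold EA
    rw [hG, indicator_of_mem (show t ∈ Ioc (0 : ℝ) 1 from ⟨ht0, ht⟩), Complex.cpow_neg_one, smul_eq_mul, ← Complex.ofReal_inv]
    refine hb.trans_eq ?_
    rw [Real.norm_of_nonneg (by positivity), neg_neg, Real.rpow_two]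
    field_simp
  have hEdiff : ∀ s : ℂ, -2 < s.re → DifferentiableAt ℂ (mellin (EA φ a κ)) s := fun s hs =>
    mellin_differentiableAt_of_isBigO_rpow (a := s.re + 1) (b := -2) (EA_locInt hφ a κ)
      (bigO_top _ (fun t ht => EA_zero hφ a κ ht)) (by linarith) hEbot hs
  have hEconv : ∀ s : ℂ, -2 < s.re → MellinConvergent (EA φ a κ) s := fun s hs =>
    mellinConvergent_of_isBigO_rpow (a := s.re + 1) (b := -2) (EA_locInt hφ a κ)
      (bigO_top _ (fun t ht => EA_zero hφ a κ ht)) (by linarith) hEbot hs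
  refine ⟨fun s => mellin (EA φ a κ) s / mellin (phC φ) s, fun s => 1 / mellin (phC φ) s,
    ?_, ?_, ?_⟩
  · intro s hs
    exact ((hEdiff s (hball s hs).2).div (phC_diff hφ s)
      (mellin_ne_zero hφ (hball s hs).1)).differentiableWithinAt
  · intro s hs
    exact ((differentiableAt_const _).div (phC_diff hφ s)
      (mellin_ne_zero hφ (hball s hs).1)).differentiableWithinAt
  · intro s hs h1
    have hne := mellin_ne_zero hφ (hball s hs).1
    have hI := hasMellin_cpow_Ioc (-1) (s := s) (by simp; linarith)
    have hI2 := hasMellin_const_smul hI.1 κ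
    have hadd := hasMellin_add (hEconv s (hball s hs).2) hI2.1
    have heq : (fun t => EA φ a κ t + κ • (Ioc (0 : ℝ) 1).indicator
        (fun t : ℝ => (t : ℂ) ^ (-1 : ℂ)) t) = GA φ a := by
      ext t
      unfold EA
      ring
    rw [heq, hI2.2, hI.2] at hadd
    have := hadd.2
    rw [mellin_GA hφ a (hsum s h1)] at this
    have hs1 : s - 1 ≠ 0 := by
      intro h
      have := congrArg Complex.re h
      simp at this
      linarith
    have h3 : s + -1 = s - 1 := by ring
    rw [h3, smul_eq_mul] at this
    field_simp
    field_simp at this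
    linear_combination this

end MellinPart

end PrimesInClasses

namespace PrimesInClasses

section Connect

open scoped Classical
open Filter Topology Asymptotics

variable {K : Type*} [Field K] [NumberField K]

lemma card_fib {n : ℕ} (hn : n ≠ 0) :
    (fib K n).card = Nat.card {I : Ideal (𝓞 K) // Ideal.absNorm I = n} := by
  have : ∀ I : Ideal (𝓞 K), I ∈ fib K n ↔ Ideal.absNorm I = n := fun I => by
    rw [mem_fib]; simp [hn]
  rw [← Nat.card_congr (Equiv.subtypeEquivRight this)]
  simp

lemma tendsto_sum_card :
    Tendsto (fun n : ℕ => (∑ k ∈ Finset.Icc 1 n, ((fib K k).card : ℝ)) / n) atTop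
      (𝓝 (dedekindZeta_residue K)) := by
  refine ((Ideal.tendsto_norm_le_div_atTop₀ K).comp tendsto_natCast_atTop_atTop).congr fun n ↦ ?_
  simp only [Function.comp_apply, Nat.cast_le, ← Nat.cast_sum]
  congr
  have : ∑ k ∈ Finset.Icc 1 n, (fib K k).card = ∑ k ∈ Finset.Icc 1 n,
      Nat.card {I : Ideal (𝓞 K) // Ideal.absNorm I = k} :=
    Finset.sum_congr rfl fun k hk => card_fib (by rw [Finset.mem_Icc] at hk; omega)
  rw [this, ← add_left_inj 1, ← Ideal.card_norm_le_eq_card_norm_le_add_one,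
    show Finset.Icc 1 n = Finset.Ioc 0 n from Finset.Icc_succ_left_eq_Ioc _ _,
    show 1 = Nat.card {I : Ideal (𝓞 K) // Ideal.absNorm I = 0} by
      simp [Ideal.absNorm_eq_zero_iff],
    Finset.sum_Ioc_add_eq_sum_Icc (n.zero_le),
    ← Finset.card_preimage_eq_sum_card_image_eq
      (fun k _ ↦ Ideal.finite_setOfPred_absNorm_eq k)]
  simp [Set.coe_eq_subtype]

lemma bigO_sum_card :
    (fun n : ℕ => ∑ k ∈ Finset.Icc 1 n, ((fib K k).card : ℝ)) =O[atTop]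
      fun n : ℕ => (n : ℝ) ^ (1 : ℝ) := by
  have h := (tendsto_sum_card (K := K)).isBigO_one ℝ
  have h2 := h.mul (isBigO_refl (fun n : ℕ => (n : ℝ)) atTop)
  refine (h2.congr' ?_ ?_)
  · filter_upwards [eventually_ne_atTop 0] with n hn
    have : (n : ℝ) ≠ 0 := by exact_mod_cast hn
    field_simp
  · filter_upwards with n
    simp

lemma norm_push_le {f : Ideal (𝓞 K) → ℂ} (hf : ∀ I, I ≠ 0 → ‖f I‖ ≤ 1) (n : ℕ) :
    ‖push f n‖ ≤ (fib K n).card := by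
  rw [push_apply]
  refine (norm_sum_le _ _).trans ?_
  refine (Finset.sum_le_card_nsmul _ _ 1 fun I hI => hf I (ne_zero_of_mem_fib hI)).trans_eq ?_
  simp

lemma push_summable {f : Ideal (𝓞 K) → ℂ} (hf : ∀ I, I ≠ 0 → ‖f I‖ ≤ 1) {s : ℂ}
    (hs : 1 < s.re) : LSeriesSummable (push f) s := by
  refine LSeriesSummable_of_sum_norm_bigO ?_ zero_le_one hs
  refine IsBigO.trans ?_ (bigO_sum_card (K := K))
  apply IsBigO.of_bound 1
  filter_upwards with n
  rw [one_mul, Real.norm_of_nonneg (Finset.sum_nonneg fun _ _ => norm_nonneg _),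
    Real.norm_of_nonneg (Finset.sum_nonneg fun _ _ => Nat.cast_nonneg _)]
  exact Finset.sum_le_sum fun k _ => norm_push_le hf k

lemma aC_summable (χ : ClassGroup (𝓞 K) →* ℂ) {s : ℂ} (hs : 1 < s.re) :
    LSeriesSummable (aC χ) s :=
  push_summable (fun _ hI => (norm_psi χ hI).le) hs

lemma LSeries_aC_one (s : ℂ) : LSeries (aC (1 : ClassGroup (𝓞 K) →* ℂ)) s = dedekindZeta K s := by
  unfold dedekindZeta
  apply LSeries_congr
  intro n hn
  unfold aC
  rw [push_apply, ← card_fib hn]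
  rw [Finset.sum_congr rfl (g := fun _ => (1 : ℂ))]
  · simp
  · intro I hI
    rw [psi_of_ne _ (ne_zero_of_mem_fib hI)]
    rfl

lemma total_summable {φ : ℝ → ℝ} (hφ : TestFn φ) (χ : ClassGroup (𝓞 K) →* ℂ) {x : ℝ} (hx : 1 ≤ x) :
    Summable (fun a : (Ideal (𝓞 K))⁰ =>
      χ (ClassGroup.mk0 a) * (φ (Ideal.absNorm (a : Ideal (𝓞 K)) / x) : ℂ)) := by
  apply summable_of_finite_support
  refine (Ideal.finite_setOfPred_absNorm_le₀ (S := 𝓞 K) ⌊x⌋₊).subset ?_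
  intro a ha
  rw [Function.mem_support] at ha
  by_contra h
  apply ha
  have h' : ¬ Ideal.absNorm (a : Ideal (𝓞 K)) ≤ ⌊x⌋₊ := h
  rw [Nat.le_floor_iff (by linarith), not_le] at h'
  rw [hφ.supp, Complex.ofReal_zero, mul_zero]
  intro h2
  have := h2.2
  rw [div_le_one (by linarith)] at this
  linarith

lemma total_class {φ : ℝ → ℝ} (χ : ClassGroup (𝓞 K) →* ℂ) {x : ℝ}
    {S : ClassGroup (𝓞 K) → ℝ} {T : ℂ}
    (hS : ∀ C, HasSum (fun a : IC C => φ (Ideal.absNorm (a.1 : Ideal (𝓞 K)) / x)) (S C))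
    (hT : HasSum (fun a : (Ideal (𝓞 K))⁰ =>
      χ (ClassGroup.mk0 a) * (φ (Ideal.absNorm (a : Ideal (𝓞 K)) / x) : ℂ)) T) :
    T = ∑ C, χ C * (S C : ℂ) := by
  have h1 := (Equiv.sigmaFiberEquiv
    (fun a : (Ideal (𝓞 K))⁰ => ClassGroup.mk0 a)).hasSum_iff.2 hT
  have h2 := h1.sigma (g := fun C => χ C * (S C : ℂ)) (fun C => by
    have h3 := (Complex.hasSum_ofReal.2 (hS C)).mul_left (χ C)
    refine h3.congr_fun ?_
    intro a
    change χ (ClassGroup.mk0 a.1) * (φ (Ideal.absNorm (a.1 : Ideal (𝓞 K)) / x) : ℂ) = _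
    rw [a.2])
  exact h2.unique (hasSum_fintype _)

lemma fiber_sum (χ : ClassGroup (𝓞 K) →* ℂ) {n : ℕ} (hn : n ≠ 0) (c : ℂ) :
    HasSum (fun a : {a : (Ideal (𝓞 K))⁰ // Ideal.absNorm (a : Ideal (𝓞 K)) = n} =>
      χ (ClassGroup.mk0 a.1) * c) (aC χ n * c) := by
  apply HasSum.mul_right
  let e : {a : (Ideal (𝓞 K))⁰ // Ideal.absNorm (a : Ideal (𝓞 K)) = n} ≃ fib K n :=
    { toFun := fun a => ⟨a.1, mem_fib.2 ⟨a.2, hn⟩⟩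
      invFun := fun I => ⟨⟨I.1, mem_nonZeroDivisors_of_ne_zero (ne_zero_of_mem_fib I.2)⟩,
        (mem_fib.1 I.2).1⟩
      left_inv := fun a => rfl
      right_inv := fun a => rfl }
  have h := hasSum_fintype (fun I : fib K n => psi χ (I : Ideal (𝓞 K)))
  rw [Finset.sum_coe_sort (fib K n) (fun I => psi χ I)] at h
  have h2 := e.hasSum_iff.2 h
  refine h2.congr_fun ?_
  intro a
  exact (psi_coe χ a.1).symm

lemma total_nat {φ : ℝ → ℝ} (hφ : TestFn φ) (χ : ClassGroup (𝓞 K) →* ℂ) {x : ℝ} {T : ℂ}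
    (hT : HasSum (fun a : (Ideal (𝓞 K))⁰ =>
      χ (ClassGroup.mk0 a) * (φ (Ideal.absNorm (a : Ideal (𝓞 K)) / x) : ℂ)) T) :
    HasSum (fun n : ℕ => aC χ n * (φ (n / x) : ℂ)) T := by
  have h1 := (Equiv.sigmaFiberEquiv
    (fun a : (Ideal (𝓞 K))⁰ => Ideal.absNorm (a : Ideal (𝓞 K)))).hasSum_iff.2 hT
  refine h1.sigma (g := fun n : ℕ => aC χ n * (φ (n / x) : ℂ)) (fun n => ?_)
  rcases eq_or_ne n 0 with rfl | hn
  · have : φ 0 = 0 := hφ.supp 0 (fun h => by have := h.1; norm_num at this)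
    simp only [Nat.cast_zero, zero_div, this, Complex.ofReal_zero, mul_zero]
    convert hasSum_zero using 1
    ext a
    exact absurd a.2 (absNorm_ne_zero' (nonZeroDivisors.coe_ne_zero a.1))
  · refine (fiber_sum χ hn (φ (n / x) : ℂ)).congr_fun ?_
    intro a
    change χ (ClassGroup.mk0 a.1) * (φ (Ideal.absNorm (a.1 : Ideal (𝓞 K)) / x) : ℂ) = _
    rw [a.2]

theorem class_L_cont {φ : ℝ → ℝ} (hφ : TestFn φ) (χ : ClassGroup (𝓞 K) →* ℂ) :
    ∃ F m : ℂ → ℂ, DifferentiableOn ℂ F (Metric.ball (3/2) 2) ∧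
      DifferentiableOn ℂ m (Metric.ball (3/2) 2) ∧
      ∀ s ∈ Metric.ball (3/2 : ℂ) 2, 1 < s.re → LSeries (aC χ) s =
        F s + (kap K φ * ∑ C, χ C) / (s - 1) * m s := by
  choose B hB0 hB using fun C : ClassGroup (𝓞 K) => class_count hφ.cont hφ.supp C
  refine mellin_cont hφ (aC χ) _ (∑ C, B C) (fun s hs => aC_summable χ hs) ?_
  intro x hx
  choose S hS hS2 using fun C => hB C x hx
  obtain ⟨T, hT⟩ := total_summable hφ χ hx
  refine ⟨T, total_nat hφ χ hT, ?_⟩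
  rw [total_class χ hS hT, Finset.sum_div]
  have : ∑ C, χ C * (S C : ℂ) - (kap K φ * ∑ C, χ C) * (x : ℂ) =
      ∑ C, χ C * ((S C - kap K φ * x : ℝ) : ℂ) := by
    rw [Finset.mul_sum, Finset.sum_mul, ← Finset.sum_sub_distrib]
    refine Finset.sum_congr rfl fun C _ => ?_
    push_cast
    ring
  rw [this]
  refine (norm_sum_le _ _).trans (Finset.sum_le_sum fun C _ => ?_)
  rw [norm_mul, norm_chi, one_mul, Complex.norm_real]
  exact hS2 C

/-- the trivial character: zeta has a continuation with a simple pole -/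
theorem zeta_cont (K : Type*) [Field K] [NumberField K] : ∃ Z : ℂ → ℂ, DifferentiableOn ℂ Z (Metric.ball (3/2) 2) ∧
    (∀ s ∈ Metric.ball (3/2 : ℂ) 2, 1 < s.re →
      (s - 1) * LSeries (aC (1 : ClassGroup (𝓞 K) →* ℂ)) s = Z s) := by
  obtain ⟨φ, hφ⟩ := exists_testFn
  obtain ⟨F, m, hF, hm, h⟩ := class_L_cont hφ (1 : ClassGroup (𝓞 K) →* ℂ)
  refine ⟨fun s => (s - 1) * F s +
    (kap K φ * ∑ C : ClassGroup (𝓞 K), (1 : ClassGroup (𝓞 K) →* ℂ) C) * m s, ?_, ?_⟩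
  · exact ((differentiableOn_id.sub_const 1).mul hF).add (hm.const_mul _)
  · intro s hs h1
    rw [h s hs h1]
    have hs1 : s - 1 ≠ 0 := by
      intro h
      have := congrArg Complex.re h
      simp at this
      linarith
    field_simp

theorem chi_cont {χ : ClassGroup (𝓞 K) →* ℂ} (hχ : χ ≠ 1) :
    ∃ F : ℂ → ℂ, DifferentiableOn ℂ F (Metric.ball (3/2) 2) ∧
    (∀ s ∈ Metric.ball (3/2 : ℂ) 2, 1 < s.re → LSeries (aC χ) s = F s) := by
  obtain ⟨φ, hφ⟩ := exists_testFn
  obtain ⟨F, m, hF, hm, h⟩ := class_L_cont hφ χ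
  refine ⟨F, hF, fun s hs h1 => ?_⟩
  rw [h s hs h1, sum_hom_units_eq_zero χ hχ]
  simp

end Connect

end PrimesInClasses

namespace PrimesInClasses

section Landau

open scoped Classical ComplexOrder
open Filter Topology

lemma single_hasSum (n : ℕ) (hn : n ≠ 0) (c s : ℂ) :
    LSeriesHasSum (Pi.single n c) s (c * (n : ℂ) ^ (-s)) := by
  have h := hasSum_single (f := LSeries.term (Pi.single n c) s) n (fun k hk => by
    rcases eq_or_ne k 0 with rfl | h0
    · simp
    · rw [LSeries.term_of_ne_zero h0, Pi.single_eq_of_ne hk, zero_div])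
  rw [LSeries.term_of_ne_zero hn, Pi.single_eq_same] at h
  rw [Complex.cpow_neg, ← div_eq_mul_inv]
  exact h

lemma landau {ρ : ℕ → ℂ} (h0 : 0 ≤ ρ) (hsum : ∀ s : ℂ, 1 < s.re → LSeriesSummable ρ s)
    {f : ℂ → ℂ} (hf : DifferentiableOn ℂ f (Metric.ball (3/2) 2))
    (hfs : ∀ s ∈ Metric.ball (3/2 : ℂ) 2, 1 < s.re → LSeries ρ s = f s) {n : ℕ} (hn : n ≠ 0) :
    ρ n * (n : ℂ) ^ (-(-1/4 : ℂ)) ≤ f (-1/4) := by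
  set ρ' : ℕ → ℂ := ρ - Pi.single n (ρ n) with hρ'
  have hpos : 0 ≤ ρ' := by
    intro k
    simp only [hρ', Pi.sub_apply, Pi.zero_apply]
    rcases eq_or_ne k n with rfl | hk
    · simp
    · rw [Pi.single_eq_of_ne hk, sub_zero]; exact h0 k
  have hsum' : ∀ s : ℂ, 1 < s.re → LSeriesHasSum ρ' s (LSeries ρ s - ρ n * (n : ℂ) ^ (-s)) :=
    fun s hs => (hsum s hs).LSeriesHasSum.sub (single_hasSum n hn (ρ n) s)
  set g : ℂ → ℂ := fun s => f s - ρ n * (n : ℂ) ^ (-s) with hg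
  have hgd : DifferentiableOn ℂ g (Metric.ball (3/2) 2) := by
    apply hf.sub
    apply DifferentiableOn.const_mul
    intro s _
    apply DifferentiableAt.differentiableWithinAt
    exact (differentiableAt_id.neg).const_cpow (Or.inl (by exact_mod_cast hn))
  have hev : g =ᶠ[𝓝 ((3/2 : ℝ) : ℂ)] LSeries ρ' := by
    have h1 : ∀ᶠ s : ℂ in 𝓝 ((3/2 : ℝ) : ℂ), 1 < s.re :=
      (Complex.continuous_re.tendsto _).eventually (lt_mem_nhds (by norm_num))
    have h2 : ∀ᶠ s : ℂ in 𝓝 ((3/2 : ℝ) : ℂ), s ∈ Metric.ball (3/2 : ℂ) 2 := by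
      apply Metric.isOpen_ball.mem_nhds
      simp
    filter_upwards [h1, h2] with s hs1 hs2
    rw [(hsum' s hs1).LSeries_eq, hfs s hs2 hs1]
  have habs : LSeries.abscissaOfAbsConv ρ' < ((3/2 : ℝ) : EReal) := by
    refine lt_of_le_of_lt (b := ((1 : ℝ) : EReal)) ?_ (by exact_mod_cast (by norm_num : (1:ℝ) < 3/2))
    apply LSeries.abscissaOfAbsConv_le_of_forall_lt_LSeriesSummable
    intro y hy
    exact (hsum' y (by simpa using hy)).LSeriesSummable
  have halt := fun k => LSeries.iteratedDeriv_alternating hpos habs k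
  have hderiv : ∀ k, 0 ≤ iteratedDeriv k (fun z => g (-z)) (-(3/2 : ℂ)) := by
    intro k
    rw [iteratedDeriv_comp_neg, neg_neg]
    have h3 := halt k
    have := hev.iteratedDeriv_eq k
    rw [← this] at h3
    simpa using h3
  have hgd' : DifferentiableOn ℂ (fun z => g (-z)) (Metric.ball (-(3/2 : ℂ)) 2) := by
    apply hgd.comp (differentiableOn_neg _)
    intro z hz
    rw [Metric.mem_ball, Complex.dist_eq] at hz ⊢
    have e : -z - 3/2 = -(z - -(3/2)) := by ring
    rw [e, norm_neg]
    exact hz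
  have hfin := hgd'.nonneg_of_iteratedDeriv_nonneg hderiv (z := 1/4) (by
      rw [Complex.le_def]; norm_num) (by
      rw [Metric.mem_ball, Complex.dist_eq]
      norm_num)
  simp only [hg] at hfin
  have h4 : -(1/4 : ℂ) = -1/4 := by ring
  rw [h4] at hfin
  exact sub_nonneg.1 hfin

/-- multiplication by log -/
noncomputable def dl (f : ArithmeticFunction ℂ) : ArithmeticFunction ℂ :=
  ⟨fun n => (Real.log n : ℂ) * f n, by simp⟩

lemma dl_apply (f : ArithmeticFunction ℂ) (n : ℕ) : dl f n = (Real.log n : ℂ) * f n := rfl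

lemma dl_mul (f g : ArithmeticFunction ℂ) : dl (f * g) = dl f * g + f * dl g := by
  ext n
  rw [dl_apply, ArithmeticFunction.add_apply, ArithmeticFunction.mul_apply,
    ArithmeticFunction.mul_apply, ArithmeticFunction.mul_apply, Finset.mul_sum,
    ← Finset.sum_add_distrib]
  refine Finset.sum_congr rfl fun p hp => ?_
  rw [Nat.mem_divisorsAntidiagonal] at hp
  have h1 : p.1 ≠ 0 := fun h => hp.2 (by rw [← hp.1, h, zero_mul])
  have h2 : p.2 ≠ 0 := fun h => hp.2 (by rw [← hp.1, h, mul_zero])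
  rw [dl_apply, dl_apply, ← hp.1, Nat.cast_mul,
    Real.log_mul (by exact_mod_cast h1) (by exact_mod_cast h2)]
  push_cast
  ring

lemma dl_mul' {f g u v : ArithmeticFunction ℂ} (hf : dl f = u * f) (hg : dl g = v * g) :
    dl (f * g) = (u + v) * (f * g) := by
  rw [dl_mul, hf, hg]; ring

lemma nonneg_of_dl {ρ b : ArithmeticFunction ℂ} (h1 : 0 ≤ ρ 1) (hb : ∀ n, 0 ≤ b n) (hb1 : b 1 = 0)
    (h : dl ρ = b * ρ) (n : ℕ) : 0 ≤ ρ n := by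
  induction n using Nat.strong_induction_on with
  | _ n ih =>
    rcases Nat.eq_zero_or_pos n with rfl | hn
    · simp
    rcases Nat.lt_or_ge 1 n with hn1 | hn1
    · have h2 : (Real.log n : ℂ) * ρ n = (b * ρ) n := by rw [← h, dl_apply]
      have h3 : 0 ≤ (b * ρ) n := by
        rw [ArithmeticFunction.mul_apply]
        apply Finset.sum_nonneg
        intro p hp
        rw [Nat.mem_divisorsAntidiagonal] at hp
        rcases eq_or_ne p.1 1 with he | he
        · rw [he, hb1, zero_mul]
        · apply mul_nonneg (hb _) (ih _ _)
          have h1 : p.1 ≠ 0 := fun h => hp.2 (by rw [← hp.1, h, zero_mul])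
          have h2 : p.2 ≠ 0 := fun h => hp.2 (by rw [← hp.1, h, mul_zero])
          rw [← hp.1]
          have : 2 ≤ p.1 := by omega
          nlinarith [Nat.pos_of_ne_zero h2]
      rw [← h2] at h3
      have hl : 0 < Real.log n := Real.log_pos (by exact_mod_cast hn1)
      have hl' : (0 : ℂ) ≤ ((Real.log n)⁻¹ : ℝ) := by
        rw [Complex.zero_le_real]; positivity
      have h5 := mul_nonneg hl' h3
      rwa [← mul_assoc, ← Complex.ofReal_mul, inv_mul_cancel₀ hl.ne', Complex.ofReal_one,
        one_mul] at h5
    · have : n = 1 := by omega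
      rw [this]; exact h1

lemma ge_of_dl {ρ b : ArithmeticFunction ℂ} (h1 : ρ 1 = 1) (hb : ∀ n, 0 ≤ b n) (hb1 : b 1 = 0)
    (h : dl ρ = b * ρ) {n : ℕ} (hn : n ≠ 0) : b n ≤ (Real.log n : ℂ) * ρ n := by
  have hρ := nonneg_of_dl (by rw [h1]; exact zero_le_one) hb hb1 h
  have h2 : (Real.log n : ℂ) * ρ n = (b * ρ) n := by rw [← h, dl_apply]
  rw [h2, ArithmeticFunction.mul_apply]
  have := Finset.single_le_sum (f := fun p : ℕ × ℕ => b p.1 * ρ p.2) (s := n.divisorsAntidiagonal)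
    (fun p _ => mul_nonneg (hb _) (hρ _)) (a := (n, 1)) (by simp [hn])
  simpa [h1] using this

end Landau

section NonVan

open scoped Classical ComplexOrder
open Filter Topology

variable {K : Type*} [Field K] [NumberField K]

/-- conjugate character -/
noncomputable def cc (χ : ClassGroup (𝓞 K) →* ℂ) : ClassGroup (𝓞 K) →* ℂ :=
  ((starRingEnd ℂ : ℂ →+* ℂ) : ℂ →* ℂ).comp χ

lemma cc_apply (χ : ClassGroup (𝓞 K) →* ℂ) (C : ClassGroup (𝓞 K)) :
    cc χ C = starRingEnd ℂ (χ C) := rfl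

lemma cc_ne_one {χ : ClassGroup (𝓞 K) →* ℂ} (h : χ ≠ 1) : cc χ ≠ 1 := by
  intro h2
  apply h
  ext C
  have := DFunLike.congr_fun h2 C
  rw [cc_apply, MonoidHom.one_apply] at this
  rw [MonoidHom.one_apply, ← Complex.conj_conj (χ C), this, map_one]

lemma psi_cc (χ : ClassGroup (𝓞 K) →* ℂ) (I : Ideal (𝓞 K)) :
    psi (cc χ) I = starRingEnd ℂ (psi χ I) := by
  unfold psi
  split_ifs
  · simp
  · rfl

lemma aC_cc (χ : ClassGroup (𝓞 K) →* ℂ) (n : ℕ) : aC (cc χ) n = starRingEnd ℂ (aC χ n) := by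
  unfold aC
  rw [push_apply, push_apply, map_sum]
  exact Finset.sum_congr rfl fun I _ => psi_cc χ I

lemma LSeries_cc (χ : ClassGroup (𝓞 K) →* ℂ) (x : ℝ) :
    LSeries (aC (cc χ)) x = starRingEnd ℂ (LSeries (aC χ) x) := by
  unfold LSeries
  rw [Complex.conj_tsum]
  congr 1
  ext n
  rcases eq_or_ne n 0 with rfl | hn
  · simp
  · rw [LSeries.term_of_ne_zero hn, LSeries.term_of_ne_zero hn, aC_cc, map_div₀]
    congr 1
    have : (n : ℂ) ^ (x : ℂ) = (((n : ℝ) ^ x : ℝ) : ℂ) := by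
      rw [Complex.ofReal_cpow (Nat.cast_nonneg n), Complex.ofReal_natCast]
    rw [this, Complex.conj_ofReal]

lemma fib_one : fib K 1 = {1} := by
  ext I
  rw [mem_fib, Finset.mem_singleton, Ideal.absNorm_eq_one_iff, Ideal.one_eq_top]
  simp

lemma psi_one (χ : ClassGroup (𝓞 K) →* ℂ) : psi χ 1 = 1 := by
  have := psi_coe χ (1 : (Ideal (𝓞 K))⁰)
  rw [map_one, map_one] at this
  exact this

lemma psi_pow (χ : ClassGroup (𝓞 K) →* ℂ) {P : Ideal (𝓞 K)} (hP : P ≠ 0) (k : ℕ) :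
    psi χ (P ^ k) = psi χ P ^ k := by
  induction k with
  | zero => rw [pow_zero, pow_zero, psi_one]
  | succ k ih => rw [pow_succ, psi_mul χ (pow_ne_zero k hP) hP, ih, pow_succ]

lemma psi_pow_card (χ : ClassGroup (𝓞 K) →* ℂ) {P : Ideal (𝓞 K)} (hP : P ≠ 0) (k : ℕ) :
    psi χ (P ^ (Fintype.card (ClassGroup (𝓞 K)) * k)) = 1 := by
  rw [psi_pow χ hP, pow_mul, psi_of_ne χ hP, ← map_pow, pow_card_eq_one, map_one, one_pow]

lemma aC_one (χ : ClassGroup (𝓞 K) →* ℂ) : aC χ 1 = 1 := by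
  unfold aC
  rw [push_apply, fib_one, Finset.sum_singleton, psi_one]

lemma vm_one : vm (1 : Ideal (𝓞 K)) = 0 := by
  apply vm_eq_zero
  exact not_isPrimePow_one

lemma LC_one (χ : ClassGroup (𝓞 K) →* ℂ) : LC χ 1 = 0 := by
  unfold LC
  rw [push_apply, fib_one, Finset.sum_singleton, vm_one]
  simp

lemma dl_aC (χ : ClassGroup (𝓞 K) →* ℂ) : dl (aC χ) = LC χ * aC χ := by
  ext n
  rw [dl_apply, log_mul_aC]

/-- the coefficient function of the log derivative -/
noncomputable def bb (χ : ClassGroup (𝓞 K) →* ℂ) : ArithmeticFunction ℂ :=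
  (LC (1 : ClassGroup (𝓞 K) →* ℂ) + LC (1 : ClassGroup (𝓞 K) →* ℂ)) + (LC χ + LC (cc χ))

lemma bb_apply (χ : ClassGroup (𝓞 K) →* ℂ) (n : ℕ) :
    bb χ n = ((∑ I ∈ fib K n, (2 + 2 * (psi χ I).re) * vm I : ℝ) : ℂ) := by
  unfold bb LC
  simp only [ArithmeticFunction.add_apply, push_apply, ← Finset.sum_add_distrib,
    Complex.ofReal_sum]
  refine Finset.sum_congr rfl fun I hI => ?_
  have h1 : psi (1 : ClassGroup (𝓞 K) →* ℂ) I = 1 := by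
    rw [psi_of_ne _ (ne_zero_of_mem_fib hI)]; rfl
  rw [psi_cc, h1]
  have := Complex.add_conj (psi χ I)
  push_cast at this ⊢
  linear_combination (vm I : ℂ) * this

lemma bb_term_nonneg (χ : ClassGroup (𝓞 K) →* ℂ) {n : ℕ} {I : Ideal (𝓞 K)} (hI : I ∈ fib K n) :
    0 ≤ (2 + 2 * (psi χ I).re) * vm I := by
  apply mul_nonneg _ (vm_nonneg I)
  have h := Complex.abs_re_le_norm (psi χ I)
  rw [norm_psi χ (ne_zero_of_mem_fib hI), abs_le] at h
  linarith [h.1]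

lemma bb_nonneg (χ : ClassGroup (𝓞 K) →* ℂ) (n : ℕ) : 0 ≤ bb χ n := by
  rw [bb_apply, Complex.zero_le_real]
  exact Finset.sum_nonneg fun I hI => bb_term_nonneg χ hI

lemma bb_one (χ : ClassGroup (𝓞 K) →* ℂ) : bb χ 1 = 0 := by
  unfold bb
  simp only [ArithmeticFunction.add_apply, LC_one, add_zero]

lemma bb_ge (χ : ClassGroup (𝓞 K) →* ℂ) {P : Ideal (𝓞 K)} (hP : Prime P) {k : ℕ} (hk : 0 < k) :
    ((4 * Real.log (Ideal.absNorm P) : ℝ) : ℂ) ≤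
      bb χ (Ideal.absNorm P ^ (Fintype.card (ClassGroup (𝓞 K)) * k)) := by
  rw [bb_apply, Complex.real_le_real]
  have hpos : 0 < Fintype.card (ClassGroup (𝓞 K)) * k := Nat.mul_pos Fintype.card_pos hk
  have hmem : P ^ (Fintype.card (ClassGroup (𝓞 K)) * k) ∈
      fib K (Ideal.absNorm P ^ (Fintype.card (ClassGroup (𝓞 K)) * k)) :=
    mem_fib.2 ⟨map_pow _ _ _, pow_ne_zero _ (absNorm_ne_zero' hP.ne_zero)⟩
  have := Finset.single_le_sum (f := fun I => (2 + 2 * (psi χ I).re) * vm I)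
    (fun I hI => bb_term_nonneg χ hI) hmem
  refine le_trans (le_of_eq ?_) this
  rw [psi_pow_card χ hP.ne_zero, vm_pow hP hpos]
  norm_num

/-- the auxiliary Dirichlet series -/
noncomputable def rr (χ : ClassGroup (𝓞 K) →* ℂ) : ArithmeticFunction ℂ :=
  (aC (1 : ClassGroup (𝓞 K) →* ℂ) * aC (1 : ClassGroup (𝓞 K) →* ℂ)) * (aC χ * aC (cc χ))

lemma rr_one (χ : ClassGroup (𝓞 K) →* ℂ) : rr χ 1 = 1 := by
  unfold rr
  simp [ArithmeticFunction.mul_apply_one, aC_one]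

lemma dl_rr (χ : ClassGroup (𝓞 K) →* ℂ) : dl (rr χ) = bb χ * rr χ :=
  dl_mul' (dl_mul' (dl_aC _) (dl_aC _)) (dl_mul' (dl_aC _) (dl_aC _))

lemma rr_nonneg (χ : ClassGroup (𝓞 K) →* ℂ) (n : ℕ) : 0 ≤ rr χ n :=
  nonneg_of_dl (by rw [rr_one]; exact zero_le_one) (bb_nonneg χ) (bb_one χ) (dl_rr χ) n

lemma rr_summable (χ : ClassGroup (𝓞 K) →* ℂ) {s : ℂ} (hs : 1 < s.re) :
    LSeriesSummable (rr χ) s :=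
  ArithmeticFunction.LSeriesSummable_mul
    (ArithmeticFunction.LSeriesSummable_mul (aC_summable _ hs) (aC_summable _ hs))
    (ArithmeticFunction.LSeriesSummable_mul (aC_summable _ hs) (aC_summable _ hs))

lemma rr_LSeries (χ : ClassGroup (𝓞 K) →* ℂ) {s : ℂ} (hs : 1 < s.re) :
    LSeries (rr χ) s = (LSeries (aC (1 : ClassGroup (𝓞 K) →* ℂ)) s *
      LSeries (aC (1 : ClassGroup (𝓞 K) →* ℂ)) s) *
      (LSeries (aC χ) s * LSeries (aC (cc χ)) s) := by
  unfold rr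
  rw [ArithmeticFunction.LSeries_mul'
    (ArithmeticFunction.LSeriesSummable_mul (aC_summable _ hs) (aC_summable _ hs))
    (ArithmeticFunction.LSeriesSummable_mul (aC_summable _ hs) (aC_summable _ hs)),
    ArithmeticFunction.LSeries_mul' (aC_summable _ hs) (aC_summable _ hs),
    ArithmeticFunction.LSeries_mul' (aC_summable _ hs) (aC_summable _ hs)]

lemma exists_prime (K : Type*) [Field K] [NumberField K] : ∃ P : Ideal (𝓞 K), Prime P := by
  obtain ⟨M, hM⟩ := Ideal.exists_maximal (𝓞 K)
  have h0 : M ≠ ⊥ := Ring.ne_bot_of_isMaximal_of_not_isField hM (RingOfIntegers.not_isField K)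
  exact ⟨M, Ideal.prime_of_isPrime h0 hM.isPrime⟩

lemma rr_unbounded (χ : ClassGroup (𝓞 K) →* ℂ) (c : ℂ)
    (h : ∀ n : ℕ, n ≠ 0 → rr χ n * (n : ℂ) ^ (-(-1/4 : ℂ)) ≤ c) : False := by
  obtain ⟨P, hP⟩ := exists_prime K
  set q := Ideal.absNorm P with hq
  set H := Fintype.card (ClassGroup (𝓞 K)) with hH
  have hHpos : 0 < H := Fintype.card_pos
  have hq2 : 2 ≤ q := two_le_absNorm hP
  have hlogq : 0 < Real.log q := Real.log_pos (by exact_mod_cast hq2)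
  set r : ℝ := (q : ℝ) ^ ((H : ℝ) * (1/4)) with hr
  have hr1 : 1 < r := Real.one_lt_rpow (by exact_mod_cast hq2) (by positivity)
  have key : ∀ k : ℕ, 0 < k → 4 * r ^ k ≤ (H * k : ℝ) * c.re := by
    intro k hk
    have hn0 : q ^ (H * k) ≠ 0 := pow_ne_zero _ (by omega)
    have h1 := (bb_ge χ hP hk).trans
      (ge_of_dl (rr_one χ) (bb_nonneg χ) (bb_one χ) (dl_rr χ) hn0)
    have h2 := h _ hn0
    have hre := rr_nonneg χ (q ^ (H * k))
    obtain ⟨t, ht⟩ : ∃ t : ℝ, rr χ (q ^ (H * k)) = (t : ℂ) :=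
      ⟨_, (Complex.eq_re_of_ofReal_le (r := 0) (by simpa using hre))⟩
    rw [ht] at h1 h2 hre
    have hcast : ((q ^ (H * k) : ℕ) : ℂ) ^ (-(-1/4 : ℂ)) = ((r ^ k : ℝ) : ℂ) := by
      have : (-(-1/4 : ℂ)) = ((1/4 : ℝ) : ℂ) := by push_cast; ring
      rw [this, ← Complex.ofReal_natCast, ← Complex.ofReal_cpow (Nat.cast_nonneg _), hr]
      congr 1
      rw [Nat.cast_pow, ← Real.rpow_natCast, ← Real.rpow_natCast,
        ← Real.rpow_mul (Nat.cast_nonneg _), ← Real.rpow_mul (Nat.cast_nonneg _)]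
      congr 1
      push_cast
      ring
    rw [hcast, ← Complex.ofReal_mul] at h2
    have h3 : t * r ^ k ≤ c.re := by
      have := (Complex.le_def.1 h2).1
      rwa [Complex.ofReal_re] at this
    rw [← Complex.ofReal_mul, Complex.real_le_real, Nat.cast_pow, Real.log_pow] at h1
    have h4 : 4 ≤ (H * k : ℝ) * t := by
      have : 4 * Real.log q ≤ ((H * k : ℝ) * t) * Real.log q := by
        push_cast at h1
        linarith
      exact le_of_mul_le_mul_right this hlogq
    have hrk : 0 < r ^ k := pow_pos (by linarith) k
    have hHk : (0 : ℝ) < H * k := by positivity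
    calc 4 * r ^ k ≤ ((H * k : ℝ) * t) * r ^ k := by gcongr
      _ = (H * k : ℝ) * (t * r ^ k) := by ring
      _ ≤ _ := by gcongr
  have hlim := tendsto_pow_const_div_const_pow_of_one_lt 1 hr1
  have hc : 0 < c.re := by
    have := key 1 one_pos
    have h2 : 0 < 4 * r ^ 1 := by positivity
    by_contra hneg
    push Not at hneg
    have : ((H : ℝ) * (1 : ℕ)) * c.re ≤ 0 := mul_nonpos_of_nonneg_of_nonpos (by positivity) hneg
    linarith
  have hev := hlim.eventually (gt_mem_nhds (show (0 : ℝ) < 4 / (H * c.re) by positivity))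
  obtain ⟨k, hk, hk0⟩ := (hev.and (eventually_gt_atTop 0)).exists
  have := key k hk0
  have hrk : 0 < r ^ k := pow_pos (by linarith) k
  have hHc : (0 : ℝ) < H * c.re := by positivity
  rw [pow_one, div_lt_div_iff₀ hrk hHc] at hk
  linarith

lemma one_mem_ball : (1 : ℂ) ∈ Metric.ball (3/2 : ℂ) 2 := by
  rw [Metric.mem_ball, Complex.dist_eq]; norm_num

lemma real_nhds : ∀ᶠ x : ℝ in 𝓝[>] 1, (x : ℂ) ∈ Metric.ball (3/2 : ℂ) 2 ∧ 1 < (x : ℂ).re := by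
  have h1 : ∀ᶠ x : ℝ in 𝓝[>] 1, (x : ℂ) ∈ Metric.ball (3/2 : ℂ) 2 := by
    apply eventually_nhdsWithin_of_eventually_nhds
    apply (Complex.continuous_ofReal.tendsto 1).eventually
    exact Metric.isOpen_ball.mem_nhds (by exact_mod_cast one_mem_ball)
  filter_upwards [h1, self_mem_nhdsWithin] with x hx hx1
  exact ⟨hx, by simpa using hx1⟩

lemma tendsto_of_diff {F : ℂ → ℂ} (hF : DifferentiableOn ℂ F (Metric.ball (3/2) 2)) :
    Tendsto (fun x : ℝ => F x) (𝓝[>] 1) (𝓝 (F 1)) := by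
  have h := (hF.differentiableAt (Metric.isOpen_ball.mem_nhds one_mem_ball)).continuousAt
  have h2 : Tendsto (fun x : ℝ => (x : ℂ)) (𝓝[>] 1) (𝓝 1) := by
    have := (Complex.continuous_ofReal.tendsto 1).mono_left (nhdsWithin_le_nhds (s := Set.Ioi 1))
    simpa using this
  exact h.tendsto.comp h2

theorem zeta_cont' (K : Type*) [Field K] [NumberField K] :
    ∃ Z : ℂ → ℂ, DifferentiableOn ℂ Z (Metric.ball (3/2) 2) ∧
    (∀ s ∈ Metric.ball (3/2 : ℂ) 2, 1 < s.re →
      (s - 1) * LSeries (aC (1 : ClassGroup (𝓞 K) →* ℂ)) s = Z s) ∧ Z 1 ≠ 0 := by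
  obtain ⟨Z, hZ, h⟩ := zeta_cont K
  refine ⟨Z, hZ, h, ?_⟩
  have h1 := tendsto_of_diff hZ
  have h2 := tendsto_sub_one_mul_dedekindZeta_nhdsGT K
  have h3 : Tendsto (fun s : ℝ ↦ ((s : ℂ) - 1) * dedekindZeta K s) (𝓝[>] 1) (𝓝 (Z 1)) := by
    refine h1.congr' ?_
    filter_upwards [real_nhds] with x hx
    rw [← h _ hx.1 hx.2, LSeries_aC_one]
  rw [tendsto_nhds_unique h3 h2]
  exact_mod_cast dedekindZeta_residue_ne_zero K

lemma cc_vanish {χ : ClassGroup (𝓞 K) →* ℂ} {F G : ℂ → ℂ}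
    (hF : DifferentiableOn ℂ F (Metric.ball (3/2) 2))
    (hFs : ∀ s ∈ Metric.ball (3/2 : ℂ) 2, 1 < s.re → LSeries (aC χ) s = F s)
    (hG : DifferentiableOn ℂ G (Metric.ball (3/2) 2))
    (hGs : ∀ s ∈ Metric.ball (3/2 : ℂ) 2, 1 < s.re → LSeries (aC (cc χ)) s = G s)
    (h0 : F 1 = 0) : G 1 = 0 := by
  have h1 := tendsto_of_diff hG
  have h2 := (Complex.continuous_conj.tendsto (F 1)).comp (tendsto_of_diff hF)
  have h3 : Tendsto (fun x : ℝ => G x) (𝓝[>] 1) (𝓝 (starRingEnd ℂ (F 1))) := by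
    refine h2.congr' ?_
    filter_upwards [real_nhds] with x hx
    rw [Function.comp_apply, ← hFs _ hx.1 hx.2, ← hGs _ hx.1 hx.2, LSeries_cc]
  rw [tendsto_nhds_unique h1 h3, h0, map_zero]

theorem chi_nonvanishing {χ : ClassGroup (𝓞 K) →* ℂ} (hχ : χ ≠ 1) {F : ℂ → ℂ}
    (hF : DifferentiableOn ℂ F (Metric.ball (3/2) 2))
    (hFs : ∀ s ∈ Metric.ball (3/2 : ℂ) 2, 1 < s.re → LSeries (aC χ) s = F s) : F 1 ≠ 0 := by
  intro h0
  obtain ⟨G, hG, hGs⟩ := chi_cont (cc_ne_one hχ)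
  have h0' := cc_vanish hF hFs hG hGs h0
  obtain ⟨Z, hZ, hZs, -⟩ := zeta_cont' K
  have hn : Metric.ball (3/2 : ℂ) 2 ∈ 𝓝 (1 : ℂ) := Metric.isOpen_ball.mem_nhds one_mem_ball
  have hF' := (Complex.differentiableOn_dslope hn).2 hF
  have hG' := (Complex.differentiableOn_dslope hn).2 hG
  have hd := (hZ.mul hZ).mul (hF'.mul hG')
  refine rr_unbounded χ _ fun n hn => landau (ρ := rr χ) (fun n => rr_nonneg χ n)
    (fun s hs => rr_summable χ hs) hd ?_ hn
  intro s hs h1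
  rw [rr_LSeries χ h1, hFs s hs h1, hGs s hs h1]
  have e1 := sub_smul_dslope F 1 s
  have e2 := sub_smul_dslope G 1 s
  rw [h0, sub_zero, smul_eq_mul] at e1
  rw [h0', sub_zero, smul_eq_mul] at e2
  have e3 := hZs s hs h1
  simp only [Pi.mul_apply]
  rw [← e1, ← e2, ← e3]
  ring

end NonVan

end PrimesInClasses

namespace PrimesInClasses

section LogDeriv

open scoped Classical
open Filter Topology

variable {K : Type*} [Field K] [NumberField K]

lemma vm_le {I : Ideal (𝓞 K)} (hI : I ≠ 0) : vm I ≤ Real.log (Ideal.absNorm I) := by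
  rw [← sum_vm I hI]
  exact Finset.single_le_sum (f := vm) (fun J _ => vm_nonneg J) ((mem_dv hI).2 dvd_rfl)

lemma aC_abscissa (χ : ClassGroup (𝓞 K) →* ℂ) {s : ℂ} (hs : 1 < s.re) :
    LSeries.abscissaOfAbsConv (aC χ) < s.re := by
  refine lt_of_le_of_lt (b := ((1 : ℝ) : EReal)) ?_ (by exact_mod_cast hs)
  apply LSeries.abscissaOfAbsConv_le_of_forall_lt_LSeriesSummable
  intro y hy
  exact aC_summable χ (by simpa using hy)

lemma logMul_aC (χ : ClassGroup (𝓞 K) →* ℂ) : LSeries.logMul (aC χ) = dl (aC χ) := by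
  ext n
  rw [dl_apply, LSeries.logMul, ← Complex.natCast_log]

lemma aC_one_eq (n : ℕ) : aC (1 : ClassGroup (𝓞 K) →* ℂ) n = ((fib K n).card : ℂ) := by
  unfold aC
  rw [push_apply, Finset.sum_congr rfl (g := fun _ => (1 : ℂ))]
  · simp
  · intro I hI
    rw [psi_of_ne _ (ne_zero_of_mem_fib hI)]
    rfl

lemma vm_push_summable {f : Ideal (𝓞 K) → ℂ} (hf : ∀ I, I ≠ 0 → ‖f I‖ ≤ vm I) {s : ℂ}
    (hs : 1 < s.re) : LSeriesSummable (push f) s := by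
  have h := LSeriesSummable_logMul_of_lt_re (aC_abscissa (1 : ClassGroup (𝓞 K) →* ℂ) hs)
  refine Summable.of_norm_bounded (Summable.norm h) ?_
  intro n
  apply LSeries.norm_term_le
  rw [logMul_aC, dl_apply, aC_one_eq, norm_mul, Complex.norm_real, Complex.norm_natCast,
    Real.norm_of_nonneg (Real.log_natCast_nonneg n), push_apply]
  refine (norm_sum_le _ _).trans ?_
  refine (Finset.sum_le_card_nsmul _ _ (Real.log n) fun I hI => ?_).trans_eq ?_
  · refine (hf I (ne_zero_of_mem_fib hI)).trans ?_
    rw [← (mem_fib.1 hI).1]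
    exact vm_le (ne_zero_of_mem_fib hI)
  · rw [nsmul_eq_mul, mul_comm]

lemma LC_summable (χ : ClassGroup (𝓞 K) →* ℂ) {s : ℂ} (hs : 1 < s.re) :
    LSeriesSummable (LC χ) s := by
  refine vm_push_summable (fun I hI => ?_) hs
  rw [norm_mul, norm_psi χ hI, one_mul, Complex.norm_real, Real.norm_of_nonneg (vm_nonneg I)]

lemma hasDeriv_aC (χ : ClassGroup (𝓞 K) →* ℂ) {s : ℂ} (hs : 1 < s.re) :
    HasDerivAt (LSeries (aC χ)) (-(LSeries (LC χ) s * LSeries (aC χ) s)) s := by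
  have h := LSeries_hasDerivAt (aC_abscissa χ hs)
  rw [logMul_aC, dl_aC, ArithmeticFunction.LSeries_mul' (LC_summable χ hs) (aC_summable χ hs)] at h
  exact h

lemma ev_ball {s : ℂ} (hs : s ∈ Metric.ball (3/2 : ℂ) 2) (h1 : 1 < s.re) :
    ∀ᶠ z in 𝓝 s, z ∈ Metric.ball (3/2 : ℂ) 2 ∧ 1 < z.re := by
  filter_upwards [Metric.isOpen_ball.mem_nhds hs,
    (Complex.continuous_re.tendsto s).eventually (lt_mem_nhds h1)] with z a b
  exact ⟨a, b⟩

lemma tendsto_sub_one : Tendsto (fun x : ℝ => (x : ℂ) - 1) (𝓝[>] 1) (𝓝 0) := by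
  have := tendsto_of_diff (F := fun s => s - 1) (differentiableOn_id.sub_const 1)
  simpa using this

theorem chi_log_deriv {χ : ClassGroup (𝓞 K) →* ℂ} (hχ : χ ≠ 1) :
    Tendsto (fun x : ℝ => ((x : ℂ) - 1) * LSeries (LC χ) x) (𝓝[>] 1) (𝓝 0) := by
  obtain ⟨F, hF, hFs⟩ := chi_cont hχ
  have hF1 := chi_nonvanishing hχ hF hFs
  have hdF := hF.deriv Metric.isOpen_ball
  have t1 := tendsto_of_diff hF
  have t2 := tendsto_of_diff hdF
  have t3 := tendsto_sub_one.mul ((t2.div t1 hF1).neg)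
  rw [zero_mul] at t3
  refine t3.congr' ?_
  filter_upwards [real_nhds, t1.eventually_ne hF1] with x hx hx0
  have hev : LSeries (aC χ) =ᶠ[𝓝 (x : ℂ)] F := by
    filter_upwards [ev_ball hx.1 hx.2] with z hz
    exact hFs z hz.1 hz.2
  have hd := (hasDeriv_aC χ hx.2).congr_of_eventuallyEq hev.symm
  simp only [Pi.div_apply]
  rw [hd.deriv, hFs _ hx.1 hx.2]
  field_simp

theorem one_log_deriv :
    Tendsto (fun x : ℝ => ((x : ℂ) - 1) * LSeries (LC (1 : ClassGroup (𝓞 K) →* ℂ)) x)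
      (𝓝[>] 1) (𝓝 1) := by
  obtain ⟨Z, hZ, hZs, hZ1⟩ := zeta_cont' K
  have hdZ := hZ.deriv Metric.isOpen_ball
  have t1 := tendsto_of_diff hZ
  have t2 := tendsto_of_diff hdZ
  have t3 := (tendsto_const_nhds (x := (1 : ℂ))).sub (tendsto_sub_one.mul ((t2.div t1 hZ1)))
  rw [zero_mul, sub_zero] at t3
  refine t3.congr' ?_
  filter_upwards [real_nhds, t1.eventually_ne hZ1] with x hx hx0
  have hev : (fun s => (s - 1) * LSeries (aC (1 : ClassGroup (𝓞 K) →* ℂ)) s) =ᶠ[𝓝 (x : ℂ)] Z := by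
    filter_upwards [ev_ball hx.1 hx.2] with z hz
    exact hZs z hz.1 hz.2
  have hd := ((((hasDerivAt_id (x : ℂ)).sub_const 1).mul
    (hasDeriv_aC (1 : ClassGroup (𝓞 K) →* ℂ) hx.2)).congr_of_eventuallyEq hev.symm)
  have e := hZs _ hx.1 hx.2
  simp only [Pi.div_apply]
  rw [hd.deriv, ← e]
  rw [← e] at hx0
  have hL : LSeries (aC (1 : ClassGroup (𝓞 K) →* ℂ)) x ≠ 0 := right_ne_zero_of_mul hx0
  have hx1 : (x : ℂ) - 1 ≠ 0 := left_ne_zero_of_mul hx0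
  simp only [id]
  field_simp
  ring

/-- characters from additive characters -/
noncomputable def toHom (ψ : AddChar (Additive (ClassGroup (𝓞 K))) ℂ) :
    ClassGroup (𝓞 K) →* ℂ where
  toFun g := ψ (Additive.ofMul g)
  map_one' := by rw [ofMul_one, AddChar.map_zero_eq_one]
  map_mul' a b := by rw [ofMul_mul, AddChar.map_add_eq_mul]

lemma toHom_apply (ψ : AddChar (Additive (ClassGroup (𝓞 K))) ℂ) (g : ClassGroup (𝓞 K)) :
    toHom ψ g = ψ (Additive.ofMul g) := rfl

lemma toHom_one : toHom (1 : AddChar (Additive (ClassGroup (𝓞 K))) ℂ) = 1 := by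
  ext g
  rw [toHom_apply, AddChar.one_apply]; rfl

lemma toHom_ne_one {ψ : AddChar (Additive (ClassGroup (𝓞 K))) ℂ} (h : ψ ≠ 1) : toHom ψ ≠ 1 := by
  intro h2
  apply h
  ext g
  have := DFunLike.congr_fun h2 (Additive.toMul g)
  rw [toHom_apply, ofMul_toMul] at this
  rw [this, AddChar.one_apply]; rfl

/-- von Mangoldt restricted to a class -/
noncomputable def vc (c : ClassGroup (𝓞 K)) (I : Ideal (𝓞 K)) : ℂ :=
  if h : I ≠ 0 then
    if ClassGroup.mk0 ⟨I, mem_nonZeroDivisors_of_ne_zero h⟩ = c then (vm I : ℂ) else 0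
  else 0

lemma sum_char (c C : ClassGroup (𝓞 K)) :
    ∑ ψ : AddChar (Additive (ClassGroup (𝓞 K))) ℂ, toHom ψ c⁻¹ * toHom ψ C =
      if C = c then (Fintype.card (ClassGroup (𝓞 K)) : ℂ) else 0 := by
  have h := AddChar.sum_apply_eq_ite (Additive.ofMul (c⁻¹ * C))
  have e : ∀ ψ : AddChar (Additive (ClassGroup (𝓞 K))) ℂ,
      toHom ψ c⁻¹ * toHom ψ C = ψ (Additive.ofMul (c⁻¹ * C)) := by
    intro ψ
    rw [← map_mul, toHom_apply]
  rw [Finset.sum_congr rfl (fun ψ _ => e ψ), h]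
  have : Additive.ofMul (c⁻¹ * C) = 0 ↔ C = c := by
    rw [ofMul_eq_zero, inv_mul_eq_one, eq_comm]
  simp only [this]
  congr 1
  rw [Fintype.card_congr Additive.toMul]

lemma push_vc (c : ClassGroup (𝓞 K)) (n : ℕ) :
    (Fintype.card (ClassGroup (𝓞 K)) : ℂ) * push (vc c) n =
      ∑ ψ : AddChar (Additive (ClassGroup (𝓞 K))) ℂ, toHom ψ c⁻¹ * LC (toHom ψ) n := by
  unfold LC
  simp_rw [push_apply, Finset.mul_sum]
  rw [Finset.sum_comm]
  refine Finset.sum_congr rfl fun I hI => ?_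
  have hI0 := ne_zero_of_mem_fib hI
  have e : ∀ ψ : AddChar (Additive (ClassGroup (𝓞 K))) ℂ,
      toHom ψ c⁻¹ * (psi (toHom ψ) I * (vm I : ℂ)) =
      (toHom ψ c⁻¹ * toHom ψ (ClassGroup.mk0 ⟨I, mem_nonZeroDivisors_of_ne_zero hI0⟩)) *
        (vm I : ℂ) := by
    intro ψ
    rw [psi_of_ne _ hI0, mul_assoc]
  rw [Finset.sum_congr rfl (fun ψ _ => e ψ), ← Finset.sum_mul, sum_char]
  unfold vc
  rw [dif_pos hI0]
  split_ifs <;> simp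

lemma LSeries_vc (c : ClassGroup (𝓞 K)) {s : ℂ} (hs : 1 < s.re) :
    (Fintype.card (ClassGroup (𝓞 K)) : ℂ) * LSeries (push (vc c)) s =
      ∑ ψ : AddChar (Additive (ClassGroup (𝓞 K))) ℂ, toHom ψ c⁻¹ * LSeries (LC (toHom ψ)) s := by
  have h1 : HasSum (LSeries.term (push (vc c)) s) (LSeries (push (vc c)) s) := by
    apply Summable.hasSum
    refine vm_push_summable (fun I hI => ?_) hs
    unfold vc
    rw [dif_pos hI]
    split_ifs
    · rw [Complex.norm_real, Real.norm_of_nonneg (vm_nonneg I)]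
    · rw [norm_zero]; exact vm_nonneg I
  have h2 := h1.mul_left (Fintype.card (ClassGroup (𝓞 K)) : ℂ)
  have h3 := hasSum_sum (s := Finset.univ)
    (fun (ψ : AddChar (Additive (ClassGroup (𝓞 K))) ℂ) _ =>
      (Summable.hasSum (LC_summable (toHom ψ) hs)).mul_left (toHom ψ c⁻¹))
  refine h2.unique ?_
  refine HasSum.congr_fun h3 ?_
  intro n
  rcases eq_or_ne n 0 with rfl | hn
  · simp
  · simp only [LSeries.term_of_ne_zero hn]
    rw [← mul_div_assoc, push_vc, Finset.sum_div]
    exact Finset.sum_congr rfl fun ψ _ => mul_div_assoc _ _ _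

theorem vc_tendsto (c : ClassGroup (𝓞 K)) :
    Tendsto (fun x : ℝ => ((x : ℂ) - 1) *
      ((Fintype.card (ClassGroup (𝓞 K)) : ℂ) * LSeries (push (vc c)) x)) (𝓝[>] 1) (𝓝 1) := by
  have h : Tendsto (fun x : ℝ => ∑ ψ : AddChar (Additive (ClassGroup (𝓞 K))) ℂ,
      toHom ψ c⁻¹ * (((x : ℂ) - 1) * LSeries (LC (toHom ψ)) x)) (𝓝[>] 1)
      (𝓝 (∑ ψ : AddChar (Additive (ClassGroup (𝓞 K))) ℂ,
        if ψ = 1 then (1 : ℂ) else 0)) := by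
    apply tendsto_finsetSum
    intro ψ _
    split_ifs with h1
    · rw [h1, toHom_one, MonoidHom.one_apply]
      simpa using (one_log_deriv (K := K))
    · have := (chi_log_deriv (toHom_ne_one h1)).const_mul (toHom ψ c⁻¹)
      rwa [mul_zero] at this
  rw [Finset.sum_ite_eq' Finset.univ, if_pos (Finset.mem_univ _)] at h
  refine h.congr' ?_
  filter_upwards [real_nhds] with x hx
  rw [LSeries_vc c hx.2, Finset.mul_sum]
  exact Finset.sum_congr rfl fun ψ _ => by ring

end LogDeriv

end PrimesInClasses

namespace PrimesInClasses

section Infinite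

open scoped Classical
open Filter Topology

variable {K : Type*} [Field K] [NumberField K]

lemma fib_disj {m n : ℕ} (h : m ≠ n) : Disjoint (fib K m) (fib K n) := by
  rw [Finset.disjoint_left]
  intro I h1 h2
  exact h ((mem_fib.1 h1).1.symm.trans (mem_fib.1 h2).1)

lemma push_bound {f : Ideal (𝓞 K) → ℂ} {w : Ideal (𝓞 K) → ℝ} (hw : Summable w)
    (hw0 : ∀ I, 0 ≤ w I)
    (hf : ∀ I, ‖f I‖ ≤ w I * Ideal.absNorm I) {x : ℝ} (hx : 1 ≤ x) :
    ‖LSeries (push f) x‖ ≤ ∑' I, w I := by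
  have key : ∀ s : Finset ℕ, ∑ n ∈ s, ‖LSeries.term (push f) x n‖ ≤ ∑' I, w I := by
    intro s
    have h1 : ∀ n ∈ s, ‖LSeries.term (push f) x n‖ ≤ ∑ I ∈ fib K n, w I := by
      intro n _
      rcases eq_or_ne n 0 with rfl | hn
      · simp only [LSeries.term_zero, norm_zero]
        exact Finset.sum_nonneg fun I _ => hw0 I
      rw [LSeries.norm_term_eq, if_neg hn, Complex.ofReal_re, push_apply]
      have hn1 : (1 : ℝ) ≤ n := by exact_mod_cast Nat.one_le_iff_ne_zero.2 hn
      have hn0 : (0 : ℝ) < n := by linarith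
      rw [div_le_iff₀ (Real.rpow_pos_of_pos hn0 x)]
      refine (norm_sum_le _ _).trans ?_
      rw [Finset.sum_mul]
      refine Finset.sum_le_sum fun I hI => (hf I).trans ?_
      rw [(mem_fib.1 hI).1]
      refine mul_le_mul_of_nonneg_left ?_ (hw0 I)
      calc (n : ℝ) = (n : ℝ) ^ (1 : ℝ) := (Real.rpow_one _).symm
        _ ≤ _ := Real.rpow_le_rpow_of_exponent_le hn1 hx
    refine (Finset.sum_le_sum h1).trans ?_
    rw [← Finset.sum_biUnion (fun m _ n _ h => fib_disj h)]
    exact hw.sum_le_tsum _ fun I _ => hw0 I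
  have hs : Summable fun n => ‖LSeries.term (push f) x n‖ :=
    summable_of_sum_le (fun n => norm_nonneg _) key
  exact (norm_tsum_le_tsum_norm hs).trans (hs.tsum_le_of_sum_le key)

lemma summable_norm_rpow :
    Summable fun I : Ideal (𝓞 K) => (Ideal.absNorm I : ℝ) ^ (-(3/2) : ℝ) := by
  have hs : Summable fun n => ‖LSeries.term (aC (1 : ClassGroup (𝓞 K) →* ℂ)) ((3/2 : ℝ) : ℂ) n‖ :=
    (aC_summable (1 : ClassGroup (𝓞 K) →* ℂ)
      (s := ((3/2 : ℝ) : ℂ)) (by rw [Complex.ofReal_re]; norm_num)).norm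
  refine summable_of_sum_le (c := ∑' n, ‖LSeries.term (aC (1 : ClassGroup (𝓞 K) →* ℂ))
    ((3/2 : ℝ) : ℂ) n‖) (fun I => by positivity) ?_
  intro S
  rw [← Finset.sum_fiberwise_of_maps_to (t := S.image Ideal.absNorm) (g := fun I => Ideal.absNorm I)
    (fun I hI => Finset.mem_image_of_mem _ hI)]
  refine le_trans (Finset.sum_le_sum fun n _ => ?_) (hs.sum_le_tsum _ fun n _ => norm_nonneg _)
  rcases eq_or_ne n 0 with rfl | hn
  · refine le_trans (le_of_eq ?_) (norm_nonneg _)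
    refine Finset.sum_eq_zero fun I hI => ?_
    rw [(Finset.mem_filter.1 hI).2, Nat.cast_zero, Real.zero_rpow (by norm_num)]
  · rw [LSeries.norm_term_eq, if_neg hn, Complex.ofReal_re, aC_one_eq, Complex.norm_natCast,
      div_eq_mul_inv (_ : ℝ) ((n : ℝ) ^ _), ← Real.rpow_neg (Nat.cast_nonneg n), ← nsmul_eq_mul, ← Finset.sum_const]
    calc _ = ∑ I ∈ S with Ideal.absNorm I = n, (n : ℝ) ^ (-(3/2) : ℝ) :=
          Finset.sum_congr rfl fun I hI => by rw [(Finset.mem_filter.1 hI).2]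
      _ ≤ _ := by
          refine Finset.sum_le_sum_of_subset_of_nonneg ?_ fun _ _ _ => by positivity
          intro I hI
          exact mem_fib.2 ⟨(Finset.mem_filter.1 hI).2, hn⟩

/-- weight of the proper prime powers -/
noncomputable def w2 (I : Ideal (𝓞 K)) : ℝ := if Prime I then 0 else vm I / Ideal.absNorm I

lemma w2_nonneg (I : Ideal (𝓞 K)) : 0 ≤ w2 I := by
  unfold w2
  split_ifs
  · exact le_rfl
  · exact div_nonneg (vm_nonneg I) (Nat.cast_nonneg _)

lemma pow_map_injective : Function.Injective
    (fun x : {P : Ideal (𝓞 K) // Prime P} × ℕ => (x.1 : Ideal (𝓞 K)) ^ (x.2 + 2)) := by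
  rintro ⟨⟨P, hP⟩, a⟩ ⟨⟨Q, hQ⟩, b⟩ h
  have h : P ^ (a + 2) = Q ^ (b + 2) := h
  have hPQ : P = Q := by
    apply prime_eq_of_dvd hP hQ
    apply hP.dvd_of_dvd_pow (n := b + 2)
    rw [← h]
    exact dvd_pow_self _ (by omega)
  subst hPQ
  have h2 := congrArg Ideal.absNorm h
  rw [map_pow, map_pow] at h2
  have h3 := Nat.pow_right_injective (two_le_absNorm hP) h2
  have : a = b := by omega
  subst this
  rfl

lemma w2_bound {P : Ideal (𝓞 K)} (hP : Prime P) (k : ℕ) :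
    w2 (P ^ (k + 2)) ≤ (2 * (Ideal.absNorm P : ℝ) ^ (-(3/2) : ℝ)) * (1/2 : ℝ) ^ k := by
  have hnp : ¬ Prime (P ^ (k + 2)) := not_prime_pow (by omega)
  unfold w2
  rw [if_neg hnp, vm_pow hP (by omega), map_pow]
  have hq2 : (2 : ℝ) ≤ Ideal.absNorm P := by exact_mod_cast two_le_absNorm hP
  push_cast
  set q : ℝ := (Ideal.absNorm P : ℝ)
  have hq0 : 0 < q := by linarith
  have h1 : Real.log q ≤ q ^ (1/2 : ℝ) / (1/2) := Real.log_le_rpow_div hq0.le (by norm_num)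
  have h2 : q ^ (-(3/2) : ℝ) = q ^ (1/2 : ℝ) / q ^ 2 := by
    rw [← Real.rpow_natCast, ← Real.rpow_sub hq0]
    norm_num
  rw [h2, pow_add, div_le_iff₀ (by positivity)]
  have h3 : (1 : ℝ) ≤ (1/2 : ℝ) ^ k * q ^ k := by
    rw [← mul_pow]
    exact one_le_pow₀ (by linarith)
  have h4 : 2 * (q ^ (1/2 : ℝ) / q ^ 2) * (1 / 2) ^ k * (q ^ k * q ^ 2) =
      2 * q ^ (1/2 : ℝ) * ((1/2) ^ k * q ^ k) := by
    field_simp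
  rw [h4]
  have h5 : 0 < q ^ (1/2 : ℝ) := Real.rpow_pos_of_pos hq0 _
  nlinarith

lemma w2_summable : Summable (w2 (K := K)) := by
  have h1 : Summable fun P : {P : Ideal (𝓞 K) // Prime P} =>
      2 * (Ideal.absNorm (P : Ideal (𝓞 K)) : ℝ) ^ (-(3/2) : ℝ) :=
    ((summable_norm_rpow (K := K)).comp_injective Subtype.val_injective).mul_left 2
  have h2 : Summable fun k : ℕ => (1/2 : ℝ) ^ k := summable_geometric_two
  have h3 := h1.mul_of_nonneg h2 (fun _ => by positivity) (fun _ => by positivity)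
  rw [← (pow_map_injective (K := K)).summable_iff]
  · exact Summable.of_nonneg_of_le (fun _ => w2_nonneg _) (fun x => w2_bound x.1.2 x.2) h3
  · intro I hI
    unfold w2
    split_ifs with hp
    · rfl
    · rw [vm_eq_zero, zero_div]
      rintro ⟨P, k, hP, hk, rfl⟩
      obtain rfl | hk2 : k = 1 ∨ 2 ≤ k := by omega
      · exact hp (by rwa [pow_one])
      · exact hI ⟨(⟨P, hP⟩, k - 2), by change P ^ (k - 2 + 2) = _; congr 1; omega⟩

/-- Every ideal class contains a prime ideal outside any given finite set. -/
theorem exists_prime_in_class (c : ClassGroup (𝓞 K)) (T : Finset (Ideal (𝓞 K))) :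
    ∃ (P : Ideal (𝓞 K)) (hP : P ≠ 0), Prime P ∧ P ∉ T ∧
      ClassGroup.mk0 ⟨P, mem_nonZeroDivisors_of_ne_zero hP⟩ = c := by
  by_contra hcon
  push Not at hcon
  let w1 : Ideal (𝓞 K) → ℝ := fun I => if I ∈ T then vm I / Ideal.absNorm I else 0
  have hw1 : Summable w1 := summable_of_ne_finset_zero (s := T) fun I hI => if_neg hI
  have hw10 : ∀ I, 0 ≤ w1 I := fun I => by
    change 0 ≤ if I ∈ T then vm I / Ideal.absNorm I else 0
    split_ifs
    · exact div_nonneg (vm_nonneg I) (Nat.cast_nonneg _)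
    · exact le_rfl
  have hb : ∀ I : Ideal (𝓞 K), ‖vc c I‖ ≤ (w1 I + w2 I) * Ideal.absNorm I := by
    intro I
    have hpos : 0 ≤ (w1 I + w2 I) * Ideal.absNorm I :=
      mul_nonneg (add_nonneg (hw10 I) (w2_nonneg I)) (Nat.cast_nonneg _)
    unfold vc
    split_ifs with h0 h1
    · rw [Complex.norm_real, Real.norm_of_nonneg (vm_nonneg I)]
      have hN : (Ideal.absNorm I : ℝ) ≠ 0 := by exact_mod_cast absNorm_ne_zero' h0
      have hmain : vm I / Ideal.absNorm I ≤ w1 I + w2 I := by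
        by_cases hp : Prime I
        · have hT : I ∈ T := by
            by_contra hT
            exact hcon I h0 hp hT h1
          have : w1 I = vm I / Ideal.absNorm I := if_pos hT
          rw [this]
          exact le_add_of_nonneg_right (w2_nonneg I)
        · have : w2 I = vm I / Ideal.absNorm I := if_neg hp
          rw [this]
          exact le_add_of_nonneg_left (hw10 I)
      calc vm I = vm I / Ideal.absNorm I * Ideal.absNorm I := by field_simp
        _ ≤ _ := mul_le_mul_of_nonneg_right hmain (Nat.cast_nonneg _)
    · rwa [norm_zero]
    · rwa [norm_zero]
  have hB := fun x (hx : (1 : ℝ) ≤ x) => push_bound (hw1.add w2_summable)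
    (fun I => add_nonneg (hw10 I) (w2_nonneg I)) hb hx
  set B := ∑' I : Ideal (𝓞 K), (w1 I + w2 I)
  have t0 : Tendsto (fun x : ℝ => ((x : ℂ) - 1) *
      ((Fintype.card (ClassGroup (𝓞 K)) : ℂ) * LSeries (push (vc c)) x)) (𝓝[>] 1) (𝓝 0) := by
    have tn : Tendsto (fun x : ℝ => ‖(x : ℂ) - 1‖ * (Fintype.card (ClassGroup (𝓞 K)) * B))
        (𝓝[>] 1) (𝓝 0) := by
      have := (tendsto_sub_one.norm).mul_const (Fintype.card (ClassGroup (𝓞 K)) * B)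
      rwa [norm_zero, zero_mul] at this
    refine squeeze_zero_norm' ?_ tn
    filter_upwards [self_mem_nhdsWithin] with x hx
    rw [norm_mul, norm_mul, Complex.norm_natCast]
    gcongr
    exact hB x (le_of_lt hx)
  exact zero_ne_one (tendsto_nhds_unique t0 (vc_tendsto c))

end Infinite

end PrimesInClasses

namespace PrimesInClasses

section Final

variable {F : Type*} [Field F] [NumberField F]

lemma exists_span_of_class {I : FractionalIdeal (𝓞 F)⁰ F} (u : (FractionalIdeal (𝓞 F)⁰ F)ˣ)
    (hu : (u : FractionalIdeal (𝓞 F)⁰ F) = I) (h : ClassGroup.mk F u = 1) :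
    ∃ l : F, spanSingleton (𝓞 F)⁰ l = I := by
  rw [ClassGroup.mk_eq_one_iff] at h
  rw [hu] at h
  obtain ⟨x, hx⟩ := (FractionalIdeal.isPrincipal_iff I).1 h
  exact ⟨x, hx.symm⟩

lemma exists_integral {I : FractionalIdeal (𝓞 F)⁰ F} (hI : I ≠ 0) {x : F} (hx : x ∈ I) :
    ∃ n : Ideal (𝓞 F), spanSingleton (𝓞 F)⁰ x = I * (n : FractionalIdeal (𝓞 F)⁰ F) := by
  have h : I⁻¹ * spanSingleton (𝓞 F)⁰ x ≤ 1 := by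
    rw [← inv_mul_cancel₀ hI]
    exact mul_le_mul_right (spanSingleton_le_iff_mem.2 hx) _
  obtain ⟨n, hn⟩ := le_one_iff_exists_coeIdeal.1 h
  exact ⟨n, by rw [hn, mul_inv_cancel_left₀ hI]⟩

theorem matrix_aux
    (p : Ideal (𝓞 F)) (hp0 : p ≠ ⊥)
    (hp2 : (ClassGroup.mk0 ⟨p, mem_nonZeroDivisors_of_ne_zero hp0⟩) ^ 2 = 1)
    (m : FractionalIdeal (𝓞 F)⁰ F) (hm : m ≠ 0) :
    ∃ (l1 l2 l3 l4 : F) (n1 n2 n3 n4 : Ideal (𝓞 F)),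
      spanSingleton (𝓞 F)⁰ l1 = (p : FractionalIdeal (𝓞 F)⁰ F) * (n1 : FractionalIdeal (𝓞 F)⁰ F) ∧
      spanSingleton (𝓞 F)⁰ l2 = (p : FractionalIdeal (𝓞 F)⁰ F) * (n2 : FractionalIdeal (𝓞 F)⁰ F) * m⁻¹ ∧
      spanSingleton (𝓞 F)⁰ l3 = (p : FractionalIdeal (𝓞 F)⁰ F) * (n3 : FractionalIdeal (𝓞 F)⁰ F) * m ∧
      spanSingleton (𝓞 F)⁰ l4 = (p : FractionalIdeal (𝓞 F)⁰ F) * (n4 : FractionalIdeal (𝓞 F)⁰ F) ∧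
      spanSingleton (𝓞 F)⁰ (l1 * l4 - l2 * l3) = ((p ^ 2 : Ideal (𝓞 F)) : FractionalIdeal (𝓞 F)⁰ F) ∧
      Prime n1 ∧ Prime n2 ∧ n1 ≠ n2 ∧ n1 ≠ p ∧ n2 ≠ p := by
  classical
  set cp := ClassGroup.mk0 (⟨p, mem_nonZeroDivisors_of_ne_zero hp0⟩ : (Ideal (𝓞 F))⁰) with hcp
  set cm := ClassGroup.mk F (Units.mk0 m hm) with hcm
  obtain ⟨n1, h10, h1p, h1T, h1c⟩ := exists_prime_in_class cp⁻¹ {p}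
  obtain ⟨n2, h20, h2p, h2T, h2c⟩ := exists_prime_in_class (cp⁻¹ * cm) {p, n1}
  simp only [Finset.mem_singleton, Finset.mem_insert, not_or] at h1T h2T
  have hP0 : (p : FractionalIdeal (𝓞 F)⁰ F) ≠ 0 := coeIdeal_ne_zero.2 hp0
  let up := FractionalIdeal.mk0 F (⟨p, mem_nonZeroDivisors_of_ne_zero hp0⟩ : (Ideal (𝓞 F))⁰)
  let u1 := FractionalIdeal.mk0 F (⟨n1, mem_nonZeroDivisors_of_ne_zero h10⟩ : (Ideal (𝓞 F))⁰)
  let u2 := FractionalIdeal.mk0 F (⟨n2, mem_nonZeroDivisors_of_ne_zero h20⟩ : (Ideal (𝓞 F))⁰)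
  have ep : ClassGroup.mk F up = cp := ClassGroup.mk_mk0 F _
  have e1 : ClassGroup.mk F u1 = cp⁻¹ := (ClassGroup.mk_mk0 F _).trans h1c
  have e2 : ClassGroup.mk F u2 = cp⁻¹ * cm := (ClassGroup.mk_mk0 F _).trans h2c
  obtain ⟨l1, hl1⟩ := exists_span_of_class
    (I := (p : FractionalIdeal (𝓞 F)⁰ F) * (n1 : FractionalIdeal (𝓞 F)⁰ F)) (up * u1) rfl
    (by rw [map_mul, ep, e1, mul_inv_cancel])
  obtain ⟨l2, hl2⟩ := exists_span_of_class
    (I := (p : FractionalIdeal (𝓞 F)⁰ F) * (n2 : FractionalIdeal (𝓞 F)⁰ F) * m⁻¹)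
    (up * u2 * (Units.mk0 m hm)⁻¹) (by rw [Units.val_mul, Units.val_inv_eq_inv_val]; rfl)
    (by rw [map_mul, map_mul, map_inv, ep, e2, ← hcm]; group)
  obtain ⟨d, hd⟩ := exists_span_of_class
    (I := ((p ^ 2 : Ideal (𝓞 F)) : FractionalIdeal (𝓞 F)⁰ F)) (up ^ 2)
    (by rw [Units.val_pow_eq_pow_val, coeIdeal_pow]; rfl) (by rw [map_pow, ep, hp2])
  -- coprimality
  have hcop : n1 ⊔ n2 = ⊤ := by
    have i1 : n1.IsPrime := Ideal.isPrime_of_prime h1p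
    have i2 : n2.IsPrime := Ideal.isPrime_of_prime h2p
    have m1 : n1.IsMaximal := i1.isMaximal h10
    have m2 : n2.IsMaximal := i2.isMaximal h20
    exact Ideal.IsMaximal.coprime_of_ne m1 m2 (Ne.symm h2T.2)
  have hsum : spanSingleton (𝓞 F)⁰ l1 * (p : FractionalIdeal (𝓞 F)⁰ F) +
      spanSingleton (𝓞 F)⁰ l2 * ((p : FractionalIdeal (𝓞 F)⁰ F) * m) =
      spanSingleton (𝓞 F)⁰ d := by
    have h : (n1 : FractionalIdeal (𝓞 F)⁰ F) + (n2 : FractionalIdeal (𝓞 F)⁰ F) = 1 := by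
      rw [← coeIdeal_sup, hcop, coeIdeal_top]
    rw [hd, hl1, hl2, coeIdeal_pow]
    calc _ = (p : FractionalIdeal (𝓞 F)⁰ F) ^ 2 * ((n1 : FractionalIdeal (𝓞 F)⁰ F) +
            (n2 : FractionalIdeal (𝓞 F)⁰ F) * (m⁻¹ * m)) := by ring
      _ = _ := by rw [inv_mul_cancel₀ hm, mul_one, h, mul_one]
  have hdm : d ∈ spanSingleton (𝓞 F)⁰ l1 * (p : FractionalIdeal (𝓞 F)⁰ F) +
      spanSingleton (𝓞 F)⁰ l2 * ((p : FractionalIdeal (𝓞 F)⁰ F) * m) := by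
    rw [hsum]
    exact mem_spanSingleton_self _ d
  obtain ⟨a, ha, b, hb, hab⟩ := (FractionalIdeal.mem_add _ _ _).1 hdm
  obtain ⟨l4, hl4, rfl⟩ := mem_singleton_mul.1 ha
  obtain ⟨l3, hl3, rfl⟩ := mem_singleton_mul.1 hb
  have hl3n : -l3 ∈ (p : FractionalIdeal (𝓞 F)⁰ F) * m :=
    neg_mem (S := Submodule (𝓞 F) F)
      (s := (((p : FractionalIdeal (𝓞 F)⁰ F) * m : FractionalIdeal (𝓞 F)⁰ F) : Submodule (𝓞 F) F)) hl3
  obtain ⟨n4, hn4⟩ := exists_integral hP0 hl4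
  obtain ⟨n3, hn3⟩ := exists_integral (mul_ne_zero hP0 hm) hl3n
  refine ⟨l1, l2, -l3, l4, n1, n2, n3, n4, hl1, hl2, ?_, hn4, ?_, h1p, h2p, Ne.symm h2T.2,
    h1T, h2T.1⟩
  · rw [hn3]; ring
  · rw [← hd, ← hab]
    congr 1
    ring

end Final

end PrimesInClasses

/-- Construction of a matrix with determinant generating `p²` (surjectivity step
of Lemma 3.3): for a prime `p` whose class is 2-torsion and any nonzero
fractional ideal `m`, there are `λ₁, λ₂, λ₃, λ₄ ∈ F` and integral ideals
`n₁, n₂, n₃, n₄` with `(λ₁) = p n₁`, `(λ₂) = p n₂ m⁻¹`, `(λ₃) = p n₃ m`,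
`(λ₄) = p n₄`, `λ₁λ₄ - λ₂λ₃` generating `p²`, where `n₁, n₂` are distinct
primes different from `p` and no prime `q ≠ p` divides all of `n₁, n₂, n₃, n₄`. -/
theorem exists_matrix_det_generating_p_squared
    (F : Type*) [Field F] [NumberField F]
    (p : Ideal (𝓞 F)) (hp : p.IsPrime) (hp0 : p ≠ ⊥)
    (hp2 : (ClassGroup.mk0 ⟨p, mem_nonZeroDivisors_of_ne_zero hp0⟩) ^ 2 = 1)
    (m : FractionalIdeal (𝓞 F)⁰ F) (hm : m ≠ 0) :
    ∃ (l1 l2 l3 l4 : F) (n1 n2 n3 n4 : Ideal (𝓞 F)),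
      spanSingleton (𝓞 F)⁰ l1 = (p : FractionalIdeal (𝓞 F)⁰ F) * (n1 : FractionalIdeal (𝓞 F)⁰ F) ∧
      spanSingleton (𝓞 F)⁰ l2 = (p : FractionalIdeal (𝓞 F)⁰ F) * (n2 : FractionalIdeal (𝓞 F)⁰ F) * m⁻¹ ∧
      spanSingleton (𝓞 F)⁰ l3 = (p : FractionalIdeal (𝓞 F)⁰ F) * (n3 : FractionalIdeal (𝓞 F)⁰ F) * m ∧
      spanSingleton (𝓞 F)⁰ l4 = (p : FractionalIdeal (𝓞 F)⁰ F) * (n4 : FractionalIdeal (𝓞 F)⁰ F) ∧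
      spanSingleton (𝓞 F)⁰ (l1 * l4 - l2 * l3) = ((p ^ 2 : Ideal (𝓞 F)) : FractionalIdeal (𝓞 F)⁰ F) ∧
      n1.IsPrime ∧ n2.IsPrime ∧ n1 ≠ n2 ∧ n1 ≠ p ∧ n2 ≠ p ∧
      (∀ q : Ideal (𝓞 F), q.IsPrime → q ≠ ⊥ → q ≠ p →
        ¬(q ∣ n1 ∧ q ∣ n2 ∧ q ∣ n3 ∧ q ∣ n4)) := by
  obtain ⟨l1, l2, l3, l4, n1, n2, n3, n4, a1, a2, a3, a4, a5, h1, h2, h12, h1p, h2p⟩ :=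
    PrimesInClasses.matrix_aux p hp0 hp2 m hm
  refine ⟨l1, l2, l3, l4, n1, n2, n3, n4, a1, a2, a3, a4, a5, Ideal.isPrime_of_prime h1,
    Ideal.isPrime_of_prime h2, h12, h1p, h2p, ?_⟩
  rintro q hq hq0 _ ⟨d1, d2, -⟩
  have hq' : Prime q := Ideal.prime_of_isPrime hq0 hq
  exact h12 ((PrimesInClasses.prime_eq_of_dvd hq' h1 d1).symm.trans
    (PrimesInClasses.prime_eq_of_dvd hq' h2 d2))
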